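/- Global well-posedness of the Boltzmann hierarchy near vacuum (Theorem 11.1, Illner–Pulvirenti). Let d ≥ 3 and ℓ > 0. Suppose F_∞(0) = {f_∞^{(s)}(0)}_{s∈ℕ} is a sequence of continuous functions f_∞^{(s)}(0) : ℝ^{2ds} → ℝ, each symmetric under particle interchange, such that for some β_0 > 0 and μ_0 ∈ ℝ: sup_{s∈ℕ} sup_{Z_s} |f_∞^{(s)}(0,Z_s)| e^{β_0 [E_s(Z_s) + I_s(Z_s)]} e^{μ_0 s} ≤ 1. Then there is a constant c_d > 0 depending only on d such that if ℓ^{−1} e^{−μ_0} β_0^{−(d+1)/2} ≤ c_d, there exists a unique sequence F_∞(t) = {f_∞^{(s)}(t)}_{s∈ℕ} of continuous symmetric functions f_∞^{(s)} : [0,∞) × ℝ^{2ds} → ℝ attaining the given data at t = 0, satisfying sup_{t≥0} sup_{s∈ℕ} sup_{Z_s} |f_∞^{(s)}(t,Z_s)| e^{(1/2)β_0 [E_s(Z_s) + I_s((X_s − V_s t, V_s))]} e^{(μ_0−1)s} ≤ 2, and solving, for each s, (∂_t + V_s·∇_{X_s}) f_∞^{(s)}(t,Z_s) = ℓ^{−1}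 (C⁰_{s+1} f_∞^{(s+1)})(t,Z_s) in the sense of distributions. -/

import Mathlib

noncomputable section
open MeasureTheory Real
open scoped InnerProductSpace BigOperators

/-- Euclidean space `ℝ^d`. -/
abbrev Rd (d : ℕ) := EuclideanSpace ℝ (Fin d)

/-- The `s`-particle phase space `(ℝ^d × ℝ^d)^s`. -/
abbrev Phase (d s : ℕ) := Fin s → Rd d × Rd d

/-- The kinetic energy `E_s(Z_s) = (1/2)∑ |v_i|²`. -/
def energy {d s : ℕ} (Z : Phase d s) : ℝ := (1 / 2) * ∑ i, ‖(Z i).2‖ ^ 2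

/-- The moment of inertia `I_s(Z_s) = (1/2)∑ |x_i|²`. -/
def inertia {d s : ℕ} (Z : Phase d s) : ℝ := (1 / 2) * ∑ i, ‖(Z i).1‖ ^ 2

/-- `I_s((X_s − V_s t, V_s)) = (1/2)∑ |x_i − t v_i|²`. -/
def inertiaShift {d s : ℕ} (t : ℝ) (Z : Phase d s) : ℝ :=
  (1 / 2) * ∑ i, ‖(Z i).1 - t • (Z i).2‖ ^ 2

/-- The transport derivative `(∂_t + V_s·∇_{X_s}) φ` of a test function. -/
def transportD {d s : ℕ} (φ : ℝ → Phase d s → ℝ) (t : ℝ) (Z : Phase d s) : ℝ :=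
  deriv (fun h : ℝ => φ (t + h) (fun i => ((Z i).1 + h • (Z i).2, (Z i).2))) 0

/-- The surface measure on the unit sphere of `ℝ^d`. -/
def sphMeas (d : ℕ) : Measure (Metric.sphere (0 : Rd d) 1) :=
  (volume : Measure (Rd d)).toSphere

/-- The Boltzmann hierarchy collision operator `C⁰_{s+1}` acting on a function of
`s+1` particles, evaluated at an `s`-particle configuration. -/
def BoltzCollOp (d s : ℕ) (g : Phase d (s + 1) → ℝ) (Z : Phase d s) : ℝ :=
  ∑ i : Fin s,
    ∫ w : Rd d,
      ∫ ω : Metric.sphere (0 : Rd d) 1,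
        (max ⟪(ω : Rd d), w - (Z i).2⟫_ℝ 0 *
            g (Fin.snoc
                (Function.update Z i
                  ((Z i).1, (Z i).2 + ⟪(ω : Rd d), w - (Z i).2⟫_ℝ • (ω : Rd d)))
                ((Z i).1, w - ⟪(ω : Rd d), w - (Z i).2⟫_ℝ • (ω : Rd d)))
          - max (-⟪(ω : Rd d), w - (Z i).2⟫_ℝ) 0 *
              g (Fin.snoc Z ((Z i).1, w))) ∂(sphMeas d)

/-- The family `f` solves the Boltzmann hierarchy
`(∂_t + V_s·∇_{X_s}) f^{(s)} = ℓ⁻¹ C⁰_{s+1} f^{(s+1)}` in the sense of distributions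
on `S × ℝ^{2ds}`, `S` being an open set of times. -/
def SolvesBoltzmannHierarchy (d : ℕ) (ℓ : ℝ) (S : Set ℝ)
    (f : (s : ℕ) → ℝ → Phase d s → ℝ) : Prop :=
  ∀ s : ℕ, 1 ≤ s → ∀ φ : ℝ → Phase d s → ℝ,
    ContDiff ℝ 1 (Function.uncurry φ) →
    HasCompactSupport (Function.uncurry φ) →
    (∀ t : ℝ, t ∉ S → ∀ Z, φ t Z = 0) →
    (∫ t in S, ∫ Z : Phase d s,
      (transportD φ t Z * f s t Z
        + ℓ⁻¹ * φ t Z * BoltzCollOp d s (f (s + 1) t) Z)) = 0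

/-- The properties required of the global solution in Theorem 11.1: continuity on
`[0,∞)`, symmetry, attainment of the initial data, the weighted bound with the
dispersive (shifted inertia) weight, and the Boltzmann hierarchy in distributions. -/
def GoodGlobalSol (d : ℕ) (ℓ β₀ μ₀ : ℝ) (f₀ : (s : ℕ) → Phase d s → ℝ)
    (f : (s : ℕ) → ℝ → Phase d s → ℝ) : Prop :=
  (∀ s : ℕ, ContinuousOn (Function.uncurry (f s))
      (Set.Ici (0 : ℝ) ×ˢ (Set.univ : Set (Phase d s)))) ∧
  (∀ s : ℕ, ∀ σ : Equiv.Perm (Fin s), ∀ t : ℝ, ∀ Z : Phase d s,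
      f s t (Z ∘ σ) = f s t Z) ∧
  (∀ s : ℕ, ∀ Z : Phase d s, f s 0 Z = f₀ s Z) ∧
  (∀ t : ℝ, 0 ≤ t → ∀ s : ℕ, 1 ≤ s → ∀ Z : Phase d s,
      |f s t Z| * exp ((1 / 2) * β₀ * (energy Z + inertiaShift t Z)) *
          exp ((μ₀ - 1) * s) ≤ 2) ∧
  SolvesBoltzmannHierarchy d ℓ (Set.Ioi (0 : ℝ)) f

instance sigmaFinite_volume_phase (d s : ℕ) : SigmaFinite (volume : Measure (Phase d s)) :=
  Measure.pi.sigmaFinite fun _ => (volume : Measure (Rd d × Rd d))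

instance isLocallyFiniteMeasure_volume_phase (d s : ℕ) :
    IsLocallyFiniteMeasure (volume : Measure (Phase d s)) :=
  Measure.pi.isLocallyFiniteMeasure (μ := fun _ => (volume : Measure (Rd d × Rd d)))

instance isOpenPosMeasure_volume_phase (d s : ℕ) :
    Measure.IsOpenPosMeasure (volume : Measure (Phase d s)) :=
  Measure.pi.isOpenPosMeasure fun _ => (volume : Measure (Rd d × Rd d))

/-! ### Free transport -/

/-- The free flow `(X, V) ↦ (X + tV, V)` on phase space. -/
def freeFlow {d s : ℕ} (t : ℝ) (Z : Phase d s) : Phase d s :=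
  fun i => ((Z i).1 + t • (Z i).2, (Z i).2)

lemma freeFlow_add {d s : ℕ} (a b : ℝ) (Z : Phase d s) :
    freeFlow a (freeFlow b Z) = freeFlow (b + a) Z := by
  funext i
  simp [freeFlow, add_smul, add_assoc]

@[simp] lemma freeFlow_zero {d s : ℕ} (Z : Phase d s) : freeFlow 0 Z = Z := by
  funext i
  simp [freeFlow]

lemma freeFlow_comp {d s : ℕ} (t : ℝ) (Z : Phase d s) (σ : Fin s → Fin s) :
    freeFlow t (Z ∘ σ) = freeFlow t Z ∘ σ := rfl

lemma contDiff_freeFlow (d s : ℕ) :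
    ContDiff ℝ 1 (fun p : ℝ × Phase d s => freeFlow p.1 p.2) := by
  unfold freeFlow
  fun_prop

@[fun_prop]
lemma Continuous.freeFlow {X : Type*} [TopologicalSpace X] {d s : ℕ} {a : X → ℝ}
    {b : X → Phase d s} (ha : Continuous a) (hb : Continuous b) :
    Continuous fun x => freeFlow (a x) (b x) :=
  (contDiff_freeFlow d s).continuous.comp (ha.prodMk hb)

/-- The free flow as a homeomorphism of space-time. -/
def flowHomeo (d s : ℕ) : ℝ × Phase d s ≃ₜ ℝ × Phase d s where
  toFun p := (p.1, freeFlow p.1 p.2)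
  invFun p := (p.1, freeFlow (-p.1) p.2)
  left_inv p := by simp [freeFlow_add]
  right_inv p := by simp [freeFlow_add]
  continuous_toFun := by fun_prop
  continuous_invFun := by fun_prop

lemma measurePreserving_freeFlow {d s : ℕ} (t : ℝ) :
    MeasurePreserving (freeFlow t : Phase d s → Phase d s) := by
  have shear : MeasurePreserving (fun p : Rd d × Rd d => (p.1 + t • p.2, p.2)) := by
    have h := MeasurePreserving.skew_product (μa := (volume : Measure (Rd d)))
      (μc := (volume : Measure (Rd d))) (MeasurePreserving.id _)
      (g := fun v x => x + t • v) (μd := volume) (by fun_prop)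
      (Filter.Eventually.of_forall fun v => map_add_right_eq_self volume (t • v))
    exact (Measure.measurePreserving_swap.comp h).comp Measure.measurePreserving_swap
  exact volume_preserving_pi (f := fun _ : Fin s => fun p : Rd d × Rd d => (p.1 + t • p.2, p.2))
    fun _ => shear

lemma integral_freeFlow {d s : ℕ} (t : ℝ) (F : Phase d s → ℝ) :
    ∫ Z, F (freeFlow t Z) = ∫ Z, F Z := by
  let e : Phase d s ≃ₜ Phase d s :=
    { toFun := freeFlow t
      invFun := freeFlow (-t)
      left_inv := fun Z => by simp [freeFlow_add]
      right_inv := fun Z => by simp [freeFlow_add]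
      continuous_toFun := by fun_prop
      continuous_invFun := by fun_prop }
  exact (measurePreserving_freeFlow t).integral_comp e.measurableEmbedding F

lemma transportD_freeFlow {d s : ℕ} (φ : ℝ → Phase d s → ℝ) (t : ℝ) (Z : Phase d s) :
    transportD φ t (freeFlow t Z) = deriv (fun τ => φ τ (freeFlow τ Z)) t := by
  have h : transportD φ t (freeFlow t Z)
      = deriv (fun h : ℝ => (fun τ => φ τ (freeFlow τ Z)) (t + h)) 0 := by
    unfold transportD
    congr 1
    funext h
    exact congrArg (φ (t + h)) (freeFlow_add h t Z)
  rw [h, deriv_comp_const_add (f := fun τ => φ τ (freeFlow τ Z)), add_zero]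

/-! ### Equivalence of the mild and the distributional transport equation -/

lemma hasDerivAt_slice {E : Type*} [NormedAddCommGroup E] [NormedSpace ℝ E]
    {ψ : ℝ × E → ℝ} (hψ : ContDiff ℝ 1 ψ) (t : ℝ) (Z : E) :
    HasDerivAt (fun τ => ψ (τ, Z)) (fderiv ℝ ψ (t, Z) (1, 0)) t := by
  have h1 := (hψ.differentiable one_ne_zero (t, Z)).hasFDerivAt
  exact h1.comp_hasDerivAt t ((hasDerivAt_id t).prodMk (hasDerivAt_const t Z))

lemma tendsto_zero_of_hasCompactSupport {E : Type*} [TopologicalSpace E]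
    {ψ : ℝ × E → ℝ} (hψ : HasCompactSupport ψ) (Z : E) (g : ℝ → ℝ) :
    Filter.Tendsto (fun t => ψ (t, Z) * g t) Filter.atTop (nhds 0) := by
  obtain ⟨R, hR⟩ := (hψ.isCompact.image continuous_fst).bddAbove
  refine tendsto_const_nhds.congr' ?_
  filter_upwards [Filter.eventually_gt_atTop R] with t ht
  have : ψ (t, Z) = 0 := by
    by_contra hne
    exact absurd (hR ⟨(t, Z), subset_tsupport _ hne, rfl⟩) (not_le.mpr ht)
  simp [this]

/-- A mild solution of the transport equation is a distributional solution. -/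
lemma transport_weak_of_mild {d s : ℕ} {f q φ : ℝ → Phase d s → ℝ}
    (hf : Continuous (Function.uncurry f)) (hq : Continuous (Function.uncurry q))
    (hm : ∀ t, 0 ≤ t → ∀ Z, f t (freeFlow t Z) = f 0 Z + ∫ τ in (0 : ℝ)..t, q τ (freeFlow τ Z))
    (hφ : ContDiff ℝ 1 (Function.uncurry φ)) (hc : HasCompactSupport (Function.uncurry φ))
    (h0 : ∀ t, t ∉ Set.Ioi (0 : ℝ) → ∀ Z, φ t Z = 0) :
    ∫ t in Set.Ioi (0 : ℝ), ∫ Z, (transportD φ t Z * f t Z + φ t Z * q t Z) = 0 := by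
  set ψ : ℝ × Phase d s → ℝ := Function.uncurry φ ∘ flowHomeo d s with hψdef
  have hψ : ContDiff ℝ 1 ψ := hφ.comp (contDiff_fst.prodMk (contDiff_freeFlow d s))
  have hψc : HasCompactSupport ψ := hc.comp_homeomorph _
  set g : ℝ → Phase d s → ℝ := fun t Z => f t (freeFlow t Z) with hg
  set p : ℝ → Phase d s → ℝ := fun t Z => q t (freeFlow t Z) with hp
  have hgc : Continuous (Function.uncurry g) := hf.comp (flowHomeo d s).continuous
  have hpc : Continuous (Function.uncurry p) := hq.comp (flowHomeo d s).continuous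
  set H : ℝ → Phase d s → ℝ :=
    fun t Z => fderiv ℝ ψ (t, Z) (1, 0) * g t Z + ψ (t, Z) * p t Z with hH
  have hψ' : Continuous fun z : ℝ × Phase d s => fderiv ℝ ψ z (1, 0) :=
    (hψ.continuous_fderiv one_ne_zero).clm_apply continuous_const
  have hψ'c : HasCompactSupport fun z : ℝ × Phase d s => fderiv ℝ ψ z (1, 0) :=
    hψc.fderiv_apply ℝ (1, 0)
  have hHc : Continuous (Function.uncurry H) :=
    (hψ'.mul hgc).add (hψ.continuous.mul hpc)
  have hHs : HasCompactSupport (Function.uncurry H) :=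
    (hψ'c.mul_right).add (hψc.mul_right)
  have hHi : Integrable (Function.uncurry H) (volume.prod volume) :=
    hHc.integrable_of_hasCompactSupport hHs
  have e1 : ∀ t, ∫ Z, (transportD φ t Z * f t Z + φ t Z * q t Z) = ∫ Z, H t Z := by
    intro t
    rw [← integral_freeFlow t]
    congr 1
    funext Z
    rw [transportD_freeFlow]
    simp only [hH]
    rw [← (hasDerivAt_slice hψ t Z).deriv]
    rfl
  simp_rw [e1]
  rw [integral_integral_swap]
  · have : ∀ Z, ∫ t in Set.Ioi (0 : ℝ), H t Z = 0 := by
      intro Z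
      have hzero : ψ (0, Z) = 0 := h0 0 (by simp) _
      have hslice : Integrable (fun t => H t Z) := by
        refine Continuous.integrable_of_hasCompactSupport
          (hHc.comp (by fun_prop : Continuous fun t : ℝ => (t, Z))) ?_
        refine HasCompactSupport.of_support_subset_isCompact
          (hHs.isCompact.image continuous_fst) ?_
        intro t ht
        exact ⟨(t, Z), subset_tsupport _ ht, rfl⟩
      have key := integral_Ioi_of_hasDerivAt_of_tendsto (a := (0 : ℝ)) (m := 0)
        (f := fun t => ψ (t, Z) * g t Z) (f' := fun t => H t Z) ?_ ?_ hslice.integrableOn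
        (tendsto_zero_of_hasCompactSupport hψc Z _)
      · rw [key, hzero]; simp
      · refine Continuous.continuousWithinAt ?_
        exact (hψ.continuous.comp (by fun_prop : Continuous fun t : ℝ => (t, Z))).mul
          (hgc.comp (by fun_prop : Continuous fun t : ℝ => (t, Z)))
      · intro t ht
        have hpt : Continuous fun τ => p τ Z :=
          hpc.comp (by fun_prop : Continuous fun t : ℝ => (t, Z))
        have d1 : HasDerivAt (fun t => g 0 Z + ∫ τ in (0 : ℝ)..t, p τ Z) (p t Z) t :=
          (intervalIntegral.integral_hasDerivAt_right (hpt.intervalIntegrable _ _)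
            (hpt.stronglyMeasurableAtFilter _ _) hpt.continuousAt).const_add _
        have d2 : HasDerivAt (fun t => g t Z) (p t Z) t := by
          refine d1.congr_of_eventuallyEq ?_
          filter_upwards [lt_mem_nhds (Set.mem_Ioi.mp ht)] with τ hτ
          simpa [hg] using hm τ hτ.le Z
        exact (hasDerivAt_slice hψ t Z).mul d2
    simp [this]
  · rw [Measure.restrict_prod_eq_prod_univ]
    exact hHi.integrableOn

/-- A continuous function with vanishing distributional derivative on `(0, ∞)` is constant. -/
lemma constant_of_weak_deriv_zero {R : ℝ → ℝ} (hR : Continuous R)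
    (h : ∀ η : ℝ → ℝ, ContDiff ℝ 1 η → HasCompactSupport η → (∀ t, t ≤ 0 → η t = 0) →
      ∫ t in Set.Ioi (0 : ℝ), deriv η t * R t = 0) :
    ∀ t, 0 ≤ t → R t = R 0 := by
  obtain ⟨θ₀, hθ₀s, hθ₀c, hθ₀d, hθ₀i⟩ : ∃ θ : ℝ → ℝ, tsupport θ ⊆ Set.Ioi 0 ∧
      HasCompactSupport θ ∧ Continuous θ ∧ ∫ t, θ t = 1 := by
    let b : ContDiffBump (2 : ℝ) := ⟨1 / 2, 1, by norm_num, by norm_num⟩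
    refine ⟨b.normed volume, ?_, b.hasCompactSupport_normed, b.continuous_normed,
      b.integral_normed⟩
    rw [b.tsupport_normed_eq]
    intro x hx
    rw [Metric.mem_closedBall, Real.dist_eq, abs_le] at hx
    have : b.rOut = 1 := rfl
    rw [this] at hx
    exact Set.mem_Ioi.mpr (by linarith [hx.1])
  set c := ∫ t, θ₀ t * R t with hc
  have key : ∀ᵐ t : ℝ, t ∈ Set.Ioi (0 : ℝ) → R t - c = 0 := by
    refine isOpen_Ioi.ae_eq_zero_of_integral_contDiff_smul_eq_zero
      ((hR.sub continuous_const).locallyIntegrable.locallyIntegrableOn _) ?_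
    intro θ hθ hθc hθs
    set k := ∫ t, θ t with hk
    set ζ : ℝ → ℝ := fun t => θ t - k * θ₀ t with hζ
    have hζc : Continuous ζ := hθ.continuous.sub (continuous_const.mul hθ₀d)
    have hζs : HasCompactSupport ζ := hθc.sub hθ₀c.mul_left
    have hζ0 : ∀ t, t ≤ 0 → ζ t = 0 := by
      intro t ht
      have a1 : θ t = 0 := image_eq_zero_of_notMem_tsupport fun h => not_lt.mpr ht (hθs h)
      have a2 : θ₀ t = 0 := image_eq_zero_of_notMem_tsupport fun h => not_lt.mpr ht (hθ₀s h)
      simp [hζ, a1, a2]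
    have iθ : Integrable θ := hθ.continuous.integrable_of_hasCompactSupport hθc
    have iθ₀ : Integrable θ₀ := hθ₀d.integrable_of_hasCompactSupport hθ₀c
    have iζ : Integrable ζ := hζc.integrable_of_hasCompactSupport hζs
    have hζi : ∫ t, ζ t = 0 := by
      rw [integral_sub iθ (iθ₀.const_mul k), integral_const_mul, hθ₀i]
      simp [hk]
    set η : ℝ → ℝ := fun t => ∫ τ in (0 : ℝ)..t, ζ τ with hη
    have hηd : ∀ t, HasDerivAt η (ζ t) t := fun t =>
      intervalIntegral.integral_hasDerivAt_right (hζc.intervalIntegrable _ _)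
        (hζc.stronglyMeasurableAtFilter _ _) hζc.continuousAt
    have hderiv : deriv η = ζ := funext fun t => (hηd t).deriv
    have hη1 : ContDiff ℝ 1 η := by
      rw [contDiff_one_iff_deriv, hderiv]
      exact ⟨fun t => (hηd t).differentiableAt, hζc⟩
    have hη0 : ∀ t, t ≤ 0 → η t = 0 := by
      intro t ht
      simp only [hη]
      rw [intervalIntegral.integral_congr (g := fun _ => (0 : ℝ))]
      · simp
      · intro τ hτ
        rw [Set.uIcc_of_ge ht] at hτ
        exact hζ0 τ hτ.2
    obtain ⟨B, hB⟩ := hζs.isCompact.bddAbove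
    have hζB : ∀ t, B < t → ζ t = 0 := fun t ht =>
      image_eq_zero_of_notMem_tsupport fun h => not_le.mpr ht (hB h)
    have hηs : HasCompactSupport η := by
      refine HasCompactSupport.intro (isCompact_Icc (a := (0 : ℝ)) (b := max B 0)) ?_
      intro t ht
      rcases le_or_gt t 0 with h1 | h1
      · exact hη0 t h1
      have h2 : max B 0 < t := by
        by_contra hle
        exact ht ⟨h1.le, not_lt.mp hle⟩
      simp only [hη]
      rw [intervalIntegral.integral_of_le h1.le]
      refine (setIntegral_eq_integral_of_forall_compl_eq_zero ?_).trans hζi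
      intro τ hτ
      rcases le_or_gt τ 0 with h3 | h3
      · exact hζ0 τ h3
      · refine hζB τ (lt_of_le_of_lt (le_max_left B 0) (h2.trans ?_))
        by_contra hle
        exact hτ ⟨h3, not_lt.mp hle⟩
    have hfin := h η hη1 hηs hη0
    rw [hderiv, setIntegral_eq_integral_of_forall_compl_eq_zero] at hfin
    · have i1 : Integrable fun t => θ t * R t :=
        (hθ.continuous.mul hR).integrable_of_hasCompactSupport hθc.mul_right
      have i2 : Integrable fun t => θ₀ t * R t :=
        (hθ₀d.mul hR).integrable_of_hasCompactSupport hθ₀c.mul_right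
      have e1 : ∫ t, ζ t * R t = (∫ t, θ t * R t) - k * c := by
        rw [hc, ← integral_const_mul, ← integral_sub i1 (i2.const_mul k)]
        congr 1; funext t; simp only [hζ]; ring
      have e2 : ∫ t, θ t • (R t - c) = (∫ t, θ t * R t) - k * c := by
        rw [hk, ← integral_mul_const, ← integral_sub i1 (iθ.mul_const c)]
        congr 1; funext t; simp only [smul_eq_mul]; ring
      rw [e2, ← e1, hfin]
    · intro t ht
      simp [hζ0 t (not_lt.mp ht)]
  have hall : Set.EqOn R (fun _ => c) (Set.Ioi 0) := by
    refine Measure.eqOn_open_of_ae_eq (μ := volume) ?_ isOpen_Ioi hR.continuousOn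
      continuousOn_const
    refine (ae_restrict_iff' measurableSet_Ioi).mpr ?_
    filter_upwards [key] with t ht hmem using sub_eq_zero.mp (ht hmem)
  have hcl : Set.EqOn R (fun _ => c) (Set.Ici 0) := by
    have := hall.closure hR continuous_const
    rwa [closure_Ioi] at this
  intro t ht
  rw [hcl ht, hcl (Set.mem_Ici.mpr le_rfl)]

/-- A continuous distributional solution of the transport equation is a mild solution. -/
lemma transport_mild_of_weak {d s : ℕ} {f q : ℝ → Phase d s → ℝ}
    (hf : Continuous (Function.uncurry f)) (hq : Continuous (Function.uncurry q))
    (hw : ∀ φ : ℝ → Phase d s → ℝ, ContDiff ℝ 1 (Function.uncurry φ) →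
      HasCompactSupport (Function.uncurry φ) → (∀ t, t ∉ Set.Ioi (0 : ℝ) → ∀ Z, φ t Z = 0) →
      ∫ t in Set.Ioi (0 : ℝ), ∫ Z, (transportD φ t Z * f t Z + φ t Z * q t Z) = 0) :
    ∀ t, 0 ≤ t → ∀ Z, f t (freeFlow t Z) = f 0 Z + ∫ τ in (0 : ℝ)..t, q τ (freeFlow τ Z) := by
  set k : ℝ → Phase d s → ℝ :=
    fun t Z => ∫ τ in (0 : ℝ)..t, q τ (freeFlow τ (freeFlow (-t) Z)) with hk
  have hkc : Continuous (Function.uncurry k) := by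
    refine intervalIntegral.continuous_parametric_intervalIntegral_of_continuous
      (X := ℝ × Phase d s) (f := fun p τ => q τ (freeFlow τ (freeFlow (-p.1) p.2))) ?_
      continuous_fst
    exact hq.comp (by fun_prop :
      Continuous fun x : (ℝ × Phase d s) × ℝ => (x.2, freeFlow x.2 (freeFlow (-x.1.1) x.1.2)))
  have hkm : ∀ t, 0 ≤ t → ∀ Z,
      k t (freeFlow t Z) = k 0 Z + ∫ τ in (0 : ℝ)..t, q τ (freeFlow τ Z) := by
    intro t _ Z
    simp [hk, freeFlow_add]
  set r : ℝ → Phase d s → ℝ := fun t Z => f t (freeFlow t Z) - k t (freeFlow t Z) with hr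
  have hrc : Continuous (Function.uncurry r) :=
    (hf.comp (flowHomeo d s).continuous).sub (hkc.comp (flowHomeo d s).continuous)
  have hχ : ∀ χ : Phase d s → ℝ, ContDiff ℝ 1 χ → HasCompactSupport χ →
      ∀ t, 0 ≤ t → ∫ Z, χ Z * r t Z = ∫ Z, χ Z * r 0 Z := by
    intro χ hχd hχc
    refine constant_of_weak_deriv_zero ?_ ?_
    · have hcont := continuous_parametric_integral_of_continuous (μ := (volume : Measure (Phase d s)))
        (f := fun t Z => χ Z * r t Z)
        ((hχd.continuous.comp continuous_snd).mul hrc) hχc.isCompact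
      refine hcont.congr fun t => setIntegral_eq_integral_of_forall_compl_eq_zero ?_
      intro Z hZ
      simp [image_eq_zero_of_notMem_tsupport hZ]
    · intro η hη hηc hη0
      set ψ : ℝ × Phase d s → ℝ := fun p => η p.1 * χ p.2 with hψ
      have hψd : ContDiff ℝ 1 ψ := (hη.comp contDiff_fst).mul (hχd.comp contDiff_snd)
      have hψc : HasCompactSupport ψ := by
        refine HasCompactSupport.intro (hηc.isCompact.prod hχc.isCompact) ?_
        intro p hp
        by_contra hne
        exact hp ⟨subset_tsupport _ (left_ne_zero_of_mul hne),
          subset_tsupport _ (right_ne_zero_of_mul hne)⟩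
      set φ : ℝ → Phase d s → ℝ := fun t Z => ψ (t, freeFlow (-t) Z) with hφ
      have hφd : ContDiff ℝ 1 (Function.uncurry φ) := by
        refine hψd.comp (contDiff_fst.prodMk ?_)
        exact (contDiff_freeFlow d s).comp (contDiff_fst.neg.prodMk contDiff_snd)
      have hφc : HasCompactSupport (Function.uncurry φ) :=
        hψc.comp_homeomorph (flowHomeo d s).symm
      have hφ0 : ∀ t, t ∉ Set.Ioi (0 : ℝ) → ∀ Z, φ t Z = 0 := by
        intro t ht Z
        simp [hφ, hψ, hη0 t (not_lt.mp ht)]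
      have w1 := hw φ hφd hφc hφ0
      have w2 := transport_weak_of_mild hkc hq hkm hφd hφc hφ0
      have hφflow : ∀ t Z, φ t (freeFlow t Z) = η t * χ Z := by
        intro t Z
        simp [hφ, hψ, freeFlow_add]
      have hDφ : ∀ t Z, transportD φ t (freeFlow t Z) = deriv η t * χ Z := by
        intro t Z
        rw [transportD_freeFlow]
        simp_rw [hφflow]
        exact deriv_mul_const (hη.differentiable one_ne_zero t) _
      have hη' : Continuous (deriv η) := hη.continuous_deriv le_rfl
      have conv : ∀ u : ℝ → Phase d s → ℝ, ∀ t,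
          ∫ Z, (transportD φ t Z * u t Z + φ t Z * q t Z)
            = ∫ Z, (deriv η t * χ Z * u t (freeFlow t Z)
                + η t * χ Z * q t (freeFlow t Z)) := by
        intro u t
        rw [← integral_freeFlow t]
        simp_rw [hDφ, hφflow]
      simp_rw [conv f] at w1
      simp_rw [conv k] at w2
      have cont2 : ∀ u : ℝ → Phase d s → ℝ, Continuous (Function.uncurry u) →
          Continuous (Function.uncurry fun t Z => deriv η t * χ Z * u t (freeFlow t Z)
            + η t * χ Z * q t (freeFlow t Z)) := by
        intro u hu
        exact (((hη'.comp continuous_fst).mul (hχd.continuous.comp continuous_snd)).mul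
          (hu.comp (flowHomeo d s).continuous)).add
          (((hη.continuous.comp continuous_fst).mul (hχd.continuous.comp continuous_snd)).mul
          (hq.comp (flowHomeo d s).continuous))
      have supp2 : ∀ u : ℝ → Phase d s → ℝ,
          HasCompactSupport (Function.uncurry fun t Z => deriv η t * χ Z * u t (freeFlow t Z)
            + η t * χ Z * q t (freeFlow t Z)) := by
        intro u
        refine HasCompactSupport.intro (hηc.isCompact.prod hχc.isCompact) ?_
        rintro ⟨t, Z⟩ hp
        by_cases ht : t ∈ tsupport η
        · have hZ : χ Z = 0 := image_eq_zero_of_notMem_tsupport fun h => hp ⟨ht, h⟩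
          simp [Function.uncurry, hZ]
        · have h1 : η t = 0 := image_eq_zero_of_notMem_tsupport ht
          have h2 : deriv η t = 0 :=
            image_eq_zero_of_notMem_tsupport fun h => ht (tsupport_deriv_subset h)
          simp [Function.uncurry, h1, h2]
      have int2 : ∀ u : ℝ → Phase d s → ℝ, Continuous (Function.uncurry u) →
          Integrable (Function.uncurry fun t Z => deriv η t * χ Z * u t (freeFlow t Z)
            + η t * χ Z * q t (freeFlow t Z)) ((volume.restrict (Set.Ioi 0)).prod volume) := by
        intro u hu
        rw [Measure.restrict_prod_eq_prod_univ]
        exact ((cont2 u hu).integrable_of_hasCompactSupport (supp2 u)).integrableOn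
      have hsub := integral_sub (int2 f hf).integral_prod_left (int2 k hkc).integral_prod_left
      simp only [Function.uncurry_apply_pair] at hsub
      rw [w1, w2, sub_zero] at hsub
      refine Eq.trans (integral_congr_ae (Filter.Eventually.of_forall fun t => ?_)) hsub
      simp only
      have slice : ∀ u : ℝ → Phase d s → ℝ, Continuous (Function.uncurry u) →
          Integrable fun Z => deriv η t * χ Z * u t (freeFlow t Z)
            + η t * χ Z * q t (freeFlow t Z) := by
        intro u hu
        refine Continuous.integrable_of_hasCompactSupport
          ((cont2 u hu).comp (by fun_prop : Continuous fun Z : Phase d s => (t, Z))) ?_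
        refine HasCompactSupport.of_support_subset_isCompact
          ((supp2 u).isCompact.image continuous_snd) ?_
        intro Z hZ
        exact ⟨(t, Z), subset_tsupport _ hZ, rfl⟩
      rw [← integral_sub (slice f hf) (slice k hkc), ← integral_const_mul]
      congr 1
      funext Z
      simp only [hr]
      ring
  intro t ht Z
  have hrt : Continuous fun Z => r t Z - r 0 Z :=
    (hrc.comp (by fun_prop : Continuous fun Z : Phase d s => (t, Z))).sub
      (hrc.comp (by fun_prop : Continuous fun Z : Phase d s => ((0 : ℝ), Z)))
  have hae : ∀ᵐ Z, r t Z - r 0 Z = 0 := by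
    refine ae_eq_zero_of_integral_contDiff_smul_eq_zero hrt.locallyIntegrable ?_
    intro χ hχd hχc
    have hχ1 : ContDiff ℝ 1 χ := hχd.of_le (by exact_mod_cast le_top)
    have i : ∀ t, Integrable fun Z => χ Z * r t Z := fun t =>
      (hχd.continuous.mul (hrc.comp (by fun_prop : Continuous fun Z : Phase d s => (t, Z)))
        ).integrable_of_hasCompactSupport hχc.mul_right
    simp_rw [smul_eq_mul, mul_sub]
    rw [integral_sub (i t) (i 0), hχ χ hχ1 hχc t ht, sub_self]
  have hzero : (fun Z => r t Z - r 0 Z) = fun _ => 0 :=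
    Continuous.ae_eq_iff_eq volume hrt continuous_const |>.mp hae
  have hZ := congrFun hzero Z
  have hk0 := hkm t ht Z
  simp only [hr, freeFlow_zero] at hZ
  linarith

/-! ### The collision operator -/

/-- The configuration entering the gain term. -/
def gainConf {d s : ℕ} (Z : Phase d s) (i : Fin s) (w : Rd d)
    (ω : Metric.sphere (0 : Rd d) 1) : Phase d (s + 1) :=
  Fin.snoc (Function.update Z i
      ((Z i).1, (Z i).2 + ⟪(ω : Rd d), w - (Z i).2⟫_ℝ • (ω : Rd d)))
    ((Z i).1, w - ⟪(ω : Rd d), w - (Z i).2⟫_ℝ • (ω : Rd d))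

/-- The configuration entering the loss term. -/
def lossConf {d s : ℕ} (Z : Phase d s) (i : Fin s) (w : Rd d) : Phase d (s + 1) :=
  Fin.snoc Z ((Z i).1, w)

/-- The integrand of the `i`-th summand of the collision operator. -/
def collTerm {d s : ℕ} (g : Phase d (s + 1) → ℝ) (Z : Phase d s) (i : Fin s) (w : Rd d)
    (ω : Metric.sphere (0 : Rd d) 1) : ℝ :=
  max ⟪(ω : Rd d), w - (Z i).2⟫_ℝ 0 * g (gainConf Z i w ω)
    - max (-⟪(ω : Rd d), w - (Z i).2⟫_ℝ) 0 * g (lossConf Z i w)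

lemma boltzCollOp_eq {d s : ℕ} (g : Phase d (s + 1) → ℝ) (Z : Phase d s) :
    BoltzCollOp d s g Z = ∑ i, ∫ w, ∫ ω, collTerm g Z i w ω ∂(sphMeas d) := rfl

instance isFiniteMeasure_sphMeas (d : ℕ) : IsFiniteMeasure (sphMeas d) := by
  unfold sphMeas
  infer_instance

/-- The total surface measure of the unit sphere. -/
def sphArea (d : ℕ) : ℝ := (sphMeas d).real Set.univ

lemma sphArea_nonneg (d : ℕ) : 0 ≤ sphArea d := measureReal_nonneg

@[fun_prop]
lemma Continuous.gainConf {X : Type*} [TopologicalSpace X] {d s : ℕ} {i : Fin s}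
    {Z : X → Phase d s} {w : X → Rd d} {ω : X → Metric.sphere (0 : Rd d) 1}
    (hZ : Continuous Z) (hw : Continuous w) (hω : Continuous ω) :
    Continuous fun x => gainConf (Z x) i (w x) (ω x) := by
  unfold _root_.gainConf
  refine Continuous.finSnoc (hZ.update i ?_) ?_ <;> fun_prop

@[fun_prop]
lemma Continuous.lossConf {X : Type*} [TopologicalSpace X] {d s : ℕ} {i : Fin s}
    {Z : X → Phase d s} {w : X → Rd d} (hZ : Continuous Z) (hw : Continuous w) :
    Continuous fun x => lossConf (Z x) i (w x) := by
  unfold _root_.lossConf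
  refine Continuous.finSnoc hZ ?_
  fun_prop

lemma continuous_collTerm {X : Type*} [TopologicalSpace X] {d s : ℕ} {i : Fin s}
    {g : X → Phase d (s + 1) → ℝ} (hg : Continuous (Function.uncurry g))
    {Z : X → Phase d s} {w : X → Rd d} {ω : X → Metric.sphere (0 : Rd d) 1}
    (hZ : Continuous Z) (hw : Continuous w) (hω : Continuous ω) :
    Continuous fun x => collTerm (g x) (Z x) i (w x) (ω x) := by
  unfold collTerm
  have h1 : Continuous fun x => g x (gainConf (Z x) i (w x) (ω x)) :=
    hg.comp (continuous_id.prodMk (hZ.gainConf hw hω))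
  have h2 : Continuous fun x => g x (lossConf (Z x) i (w x)) :=
    hg.comp (continuous_id.prodMk (hZ.lossConf hw))
  fun_prop

lemma abs_collTerm_le {d s : ℕ} {g : Phase d (s + 1) → ℝ} {Z : Phase d s} {i : Fin s} {w : Rd d}
    {ω : Metric.sphere (0 : Rd d) 1} {B : ℝ} (h1 : |g (gainConf Z i w ω)| ≤ B)
    (h2 : |g (lossConf Z i w)| ≤ B) : |collTerm g Z i w ω| ≤ ‖w - (Z i).2‖ * B := by
  have hB : 0 ≤ B := (abs_nonneg _).trans h1
  set a := ⟪(ω : Rd d), w - (Z i).2⟫_ℝ with ha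
  have hω : ‖(ω : Rd d)‖ = 1 := by simp
  have hale : |a| ≤ ‖w - (Z i).2‖ := by
    simpa [hω] using abs_real_inner_le_norm (ω : Rd d) (w - (Z i).2)
  have hsum : max a 0 + max (-a) 0 = |a| := by
    rcases le_total a 0 with h | h
    · simp [h, abs_of_nonpos]
    · simp [h, abs_of_nonneg]
  calc |collTerm g Z i w ω|
      ≤ |max a 0 * g (gainConf Z i w ω)| + |max (-a) 0 * g (lossConf Z i w)| := abs_sub _ _
    _ = max a 0 * |g (gainConf Z i w ω)| + max (-a) 0 * |g (lossConf Z i w)| := by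
        rw [abs_mul, abs_mul, abs_of_nonneg (le_max_right a 0),
          abs_of_nonneg (le_max_right (-a) 0)]
    _ ≤ max a 0 * B + max (-a) 0 * B := by gcongr
    _ = |a| * B := by rw [← add_mul, hsum]
    _ ≤ ‖w - (Z i).2‖ * B := by gcongr

lemma abs_integral_sphere_collTerm_le {d s : ℕ} {g : Phase d (s + 1) → ℝ} {Z : Phase d s}
    {i : Fin s} {w : Rd d} {B : ℝ} (h1 : ∀ ω, |g (gainConf Z i w ω)| ≤ B)
    (h2 : |g (lossConf Z i w)| ≤ B) :
    |∫ ω, collTerm g Z i w ω ∂(sphMeas d)| ≤ sphArea d * (‖w - (Z i).2‖ * B) := by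
  have := norm_integral_le_of_norm_le_const (μ := sphMeas d)
    (f := fun ω => collTerm g Z i w ω) (C := ‖w - (Z i).2‖ * B)
    (Filter.Eventually.of_forall fun ω => abs_collTerm_le (h1 ω) h2)
  rw [mul_comm]
  exact this

/-- Conservation of kinetic energy in a binary collision. -/
lemma norm_sq_postcollisional {d : ℕ} (v w : Rd d) (ω : Metric.sphere (0 : Rd d) 1) :
    ‖v + ⟪(ω : Rd d), w - v⟫_ℝ • (ω : Rd d)‖ ^ 2 + ‖w - ⟪(ω : Rd d), w - v⟫_ℝ • (ω : Rd d)‖ ^ 2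
      = ‖v‖ ^ 2 + ‖w‖ ^ 2 := by
  have hω : ‖(ω : Rd d)‖ = 1 := by simp
  rw [norm_add_sq_real, norm_sub_sq_real, inner_smul_right, inner_smul_right, norm_smul, hω,
    real_inner_comm (ω : Rd d) v, real_inner_comm (ω : Rd d) w, mul_one, Real.norm_eq_abs,
    sq_abs, inner_sub_right]
  ring

lemma energy_gainConf {d s : ℕ} (Z : Phase d s) (i : Fin s) (w : Rd d)
    (ω : Metric.sphere (0 : Rd d) 1) :
    energy (gainConf Z i w ω) = energy Z + ‖w‖ ^ 2 / 2 := by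
  unfold energy gainConf
  rw [Fin.sum_univ_castSucc]
  simp only [Fin.snoc_castSucc, Fin.snoc_last]
  have hsplit : ∀ F : Fin s → ℝ, ∑ j, F j = F i + ∑ j ∈ Finset.univ.erase i, F j := fun F =>
    (Finset.add_sum_erase _ F (Finset.mem_univ i)).symm
  rw [hsplit, hsplit (fun j => ‖(Z j).2‖ ^ 2)]
  have hrest : ∑ j ∈ Finset.univ.erase i, ‖(Function.update Z i
      ((Z i).1, (Z i).2 + ⟪(ω : Rd d), w - (Z i).2⟫_ℝ • (ω : Rd d)) j).2‖ ^ 2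
      = ∑ j ∈ Finset.univ.erase i, ‖(Z j).2‖ ^ 2 := by
    refine Finset.sum_congr rfl fun j hj => ?_
    rw [Function.update_of_ne (Finset.ne_of_mem_erase hj)]
  rw [hrest, Function.update_self]
  have := norm_sq_postcollisional (Z i).2 w ω
  linarith

lemma energy_lossConf {d s : ℕ} (Z : Phase d s) (i : Fin s) (w : Rd d) :
    energy (lossConf Z i w) = energy Z + ‖w‖ ^ 2 / 2 := by
  unfold energy lossConf
  rw [Fin.sum_univ_castSucc]
  simp only [Fin.snoc_castSucc, Fin.snoc_last]
  ring

lemma energy_nonneg {d s : ℕ} (Z : Phase d s) : 0 ≤ energy Z := by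
  unfold energy
  positivity

lemma integrable_gaussian {d : ℕ} {b : ℝ} (hb : 0 < b) :
    Integrable fun w : Rd d => exp (-b * ‖w‖ ^ 2) := by
  by_contra h
  have h1 := GaussianFourier.integral_rexp_neg_mul_sq_norm (V := Rd d) hb
  rw [integral_undef h] at h1
  exact absurd h1.symm (Real.rpow_pos_of_pos (by positivity) _).ne'

lemma integrable_norm_mul_gaussian {d : ℕ} {b : ℝ} (hb : 0 < b) :
    Integrable fun w : Rd d => ‖w‖ * exp (-b * ‖w‖ ^ 2) := by
  have h := (integrable_gaussian (d := d) (b := b / 2) (by positivity)).const_mul (1 + 1 / b)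
  refine h.mono' (by fun_prop) (Filter.Eventually.of_forall fun w => ?_)
  rw [Real.norm_of_nonneg (by positivity)]
  have e1 : exp (-b * ‖w‖ ^ 2) = exp (-(b / 2 * ‖w‖ ^ 2)) * exp (-(b / 2) * ‖w‖ ^ 2) := by
    rw [← exp_add]; congr 1; ring
  have hx : ‖w‖ ≤ (1 + 1 / b) * exp (b / 2 * ‖w‖ ^ 2) := by
    have h2 : 1 + b / 2 * ‖w‖ ^ 2 ≤ exp (b / 2 * ‖w‖ ^ 2) := by
      linarith [add_one_le_exp (b / 2 * ‖w‖ ^ 2)]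
    have h3 : (1 + 1 / b) * (1 + b / 2 * ‖w‖ ^ 2)
        = 1 + 1 / b + b / 2 * ‖w‖ ^ 2 + ‖w‖ ^ 2 / 2 := by field_simp; ring
    have h4 : 0 ≤ b / 2 * ‖w‖ ^ 2 + 1 / b := by positivity
    have h5 : (1 + 1 / b) * (1 + b / 2 * ‖w‖ ^ 2) ≤ (1 + 1 / b) * exp (b / 2 * ‖w‖ ^ 2) := by
      gcongr
    nlinarith [sq_nonneg (‖w‖ - 1)]
  rw [e1, ← mul_assoc]
  gcongr
  rw [exp_neg, ← div_eq_mul_inv, div_le_iff₀ (exp_pos _)]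
  exact hx

lemma integrable_norm_sub_mul_gaussian {d : ℕ} {b : ℝ} (hb : 0 < b) (c : ℝ) :
    Integrable fun w : Rd d => (‖w‖ + c) * exp (-b * ‖w‖ ^ 2) := by
  simp_rw [add_mul]
  exact (integrable_norm_mul_gaussian hb).add ((integrable_gaussian hb).const_mul c)

/-- The sphere average in the collision operator depends continuously on all its parameters. -/
lemma continuous_integral_sphere_collTerm {d s : ℕ} {i : Fin s} {h : ℝ → Phase d (s + 1) → ℝ}
    (hh : Continuous (Function.uncurry h)) :
    Continuous fun x : (ℝ × Phase d s) × Rd d =>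
      ∫ ω, collTerm (h x.1.1) x.1.2 i x.2 ω ∂(sphMeas d) := by
  have hc : Continuous (Function.uncurry fun (x : (ℝ × Phase d s) × Rd d)
      (ω : Metric.sphere (0 : Rd d) 1) => collTerm (h x.1.1) x.1.2 i x.2 ω) := by
    refine continuous_collTerm
      (g := fun x : ((ℝ × Phase d s) × Rd d) × Metric.sphere (0 : Rd d) 1 => h x.1.1.1)
      ?_ (by fun_prop) (by fun_prop) (by fun_prop)
    exact hh.comp (by fun_prop : Continuous fun y :
      (((ℝ × Phase d s) × Rd d) × Metric.sphere (0 : Rd d) 1) × Phase d (s + 1) =>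
        (y.1.1.1.1, y.2))
  have := continuous_parametric_integral_of_continuous (μ := sphMeas d) hc isCompact_univ
  simpa using this

/-- Gaussian decay of `g` in the velocities controls the collision integrand. -/
lemma abs_integral_sphere_collTerm_le_of_energy {d s : ℕ} {g : Phase d (s + 1) → ℝ} {K b : ℝ}
    (hb : 0 < b) (hg : ∀ Z, |g Z| ≤ K * exp (-b * energy Z)) (Z : Phase d s) (i : Fin s)
    (w : Rd d) :
    |∫ ω, collTerm g Z i w ω ∂(sphMeas d)|
      ≤ sphArea d * K * ((‖w‖ + ‖(Z i).2‖) * exp (-(b / 2) * ‖w‖ ^ 2)) := by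
  have hK : 0 ≤ K := nonneg_of_mul_nonneg_left ((abs_nonneg _).trans (hg (lossConf Z i w)))
    (exp_pos _)
  have hexp : K * exp (-b * (energy Z + ‖w‖ ^ 2 / 2)) ≤ K * exp (-(b / 2) * ‖w‖ ^ 2) := by
    refine mul_le_mul_of_nonneg_left (exp_le_exp.mpr ?_) hK
    nlinarith [mul_nonneg hb.le (energy_nonneg Z)]
  refine (abs_integral_sphere_collTerm_le (B := K * exp (-(b / 2) * ‖w‖ ^ 2)) ?_ ?_).trans ?_
  · intro ω
    refine (hg _).trans ?_
    rwa [energy_gainConf]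
  · refine (hg _).trans ?_
    rwa [energy_lossConf]
  · have hA := sphArea_nonneg d
    calc sphArea d * (‖w - (Z i).2‖ * (K * exp (-(b / 2) * ‖w‖ ^ 2)))
        ≤ sphArea d * ((‖w‖ + ‖(Z i).2‖) * (K * exp (-(b / 2) * ‖w‖ ^ 2))) := by
          gcongr
          exact norm_sub_le _ _
      _ = _ := by ring

/-- The collision operator preserves joint continuity for functions with Gaussian decay. -/
lemma continuous_boltzCollOp {d s : ℕ} {h : ℝ → Phase d (s + 1) → ℝ} {K b : ℝ} (hb : 0 < b)
    (hh : Continuous (Function.uncurry h)) (hK : ∀ t Z, |h t Z| ≤ K * exp (-b * energy Z)) :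
    Continuous (Function.uncurry fun t Z => BoltzCollOp d s (h t) Z) := by
  simp only [boltzCollOp_eq, Function.uncurry_def]
  refine continuous_finsetSum _ fun i _ => ?_
  have hJ := continuous_integral_sphere_collTerm (i := i) hh
  have hK0 : 0 ≤ K := nonneg_of_mul_nonneg_left ((abs_nonneg _).trans (hK 0 fun _ => 0)) (exp_pos _)
  have hA := sphArea_nonneg d
  rw [continuous_iff_continuousAt]
  intro p₀
  refine continuousAt_of_dominated
    (bound := fun w => sphArea d * K
      * ((‖w‖ + (‖(p₀.2 i).2‖ + 1)) * exp (-(b / 2) * ‖w‖ ^ 2))) ?_ ?_ ?_ ?_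
  · refine Filter.Eventually.of_forall fun p => ?_
    exact (hJ.comp (by fun_prop : Continuous fun w : Rd d => (p, w))).aestronglyMeasurable
  · have hnear : ∀ᶠ p in nhds p₀, ‖(p.2 i).2‖ < ‖(p₀.2 i).2‖ + 1 := by
      have hc : Continuous fun p : ℝ × Phase d s => ‖(p.2 i).2‖ := by fun_prop
      exact hc.continuousAt.eventually (gt_mem_nhds (lt_add_one _))
    filter_upwards [hnear] with p hp
    refine Filter.Eventually.of_forall fun w => ?_
    refine (abs_integral_sphere_collTerm_le_of_energy hb (hK p.1) p.2 i w).trans ?_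
    gcongr
  · exact (integrable_norm_sub_mul_gaussian (by positivity) _).const_mul _
  · refine Filter.Eventually.of_forall fun w => ?_
    exact (hJ.comp (by fun_prop : Continuous fun p : ℝ × Phase d s => (p, w))).continuousAt

lemma integrable_integral_sphere_collTerm {d s : ℕ} {g : Phase d (s + 1) → ℝ} {K b : ℝ}
    (hb : 0 < b) (hg : Continuous g) (hK : ∀ Z, |g Z| ≤ K * exp (-b * energy Z))
    (Z : Phase d s) (i : Fin s) :
    Integrable fun w => ∫ ω, collTerm g Z i w ω ∂(sphMeas d) := by
  refine ((integrable_norm_sub_mul_gaussian (b := b / 2) (by positivity)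
    ‖(Z i).2‖).const_mul (sphArea d * K)).mono' ?_
    (Filter.Eventually.of_forall fun w => abs_integral_sphere_collTerm_le_of_energy hb hK Z i w)
  have hJ := continuous_integral_sphere_collTerm (i := i) (h := fun _ => g)
    (hg.comp continuous_snd)
  exact (hJ.comp (by fun_prop : Continuous fun w : Rd d => (((0 : ℝ), Z), w))).aestronglyMeasurable

lemma boltzCollOp_sub {d s : ℕ} {g h : Phase d (s + 1) → ℝ} {K K' b : ℝ} (hb : 0 < b)
    (hg : Continuous g) (hh : Continuous h) (hKg : ∀ Z, |g Z| ≤ K * exp (-b * energy Z))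
    (hKh : ∀ Z, |h Z| ≤ K' * exp (-b * energy Z)) (Z : Phase d s) :
    BoltzCollOp d s (fun Y => g Y - h Y) Z = BoltzCollOp d s g Z - BoltzCollOp d s h Z := by
  simp only [boltzCollOp_eq]
  rw [← Finset.sum_sub_distrib]
  refine Finset.sum_congr rfl fun i _ => ?_
  rw [← integral_sub (integrable_integral_sphere_collTerm hb hg hKg Z i)
    (integrable_integral_sphere_collTerm hb hh hKh Z i)]
  congr 1
  funext w
  have hi : ∀ k : Phase d (s + 1) → ℝ, Continuous k →
      Integrable (fun ω => collTerm k Z i w ω) (sphMeas d) := by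
    intro k hk
    refine Continuous.integrable_of_hasCompactSupport ?_ (HasCompactSupport.of_compactSpace _)
    exact continuous_collTerm (g := fun _ => k) (hk.comp continuous_snd) (by fun_prop)
      (by fun_prop) (by fun_prop)
  rw [← integral_sub (hi g hg) (hi h hh)]
  congr 1
  funext ω
  unfold collTerm
  ring

/-- The extension of a permutation of `Fin s` to `Fin (s + 1)` fixing the last element. -/
def permSnoc {s : ℕ} (σ : Equiv.Perm (Fin s)) : Equiv.Perm (Fin (s + 1)) :=
  finSuccEquivLast.trans ((Equiv.optionCongr σ).trans finSuccEquivLast.symm)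

lemma snoc_comp_perm {α : Type*} {s : ℕ} (Y : Fin s → α) (y : α) (σ : Equiv.Perm (Fin s)) :
    (Fin.snoc (Y ∘ σ) y : Fin (s + 1) → α) = (Fin.snoc Y y : Fin (s + 1) → α) ∘ permSnoc σ := by
  funext j
  refine Fin.lastCases ?_ (fun j => ?_) j
  · simp [permSnoc]
  · simp [permSnoc]

lemma update_comp_perm {α : Type*} {s : ℕ} (Y : Fin s → α) (i : Fin s) (y : α)
    (σ : Equiv.Perm (Fin s)) :
    Function.update (Y ∘ σ) i y = Function.update Y (σ i) y ∘ σ := by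
  rw [Function.update_comp_equiv, Equiv.symm_apply_apply]

lemma boltzCollOp_comp_perm {d s : ℕ} {g : Phase d (s + 1) → ℝ}
    (hg : ∀ σ : Equiv.Perm (Fin (s + 1)), ∀ Z, g (Z ∘ σ) = g Z) (σ : Equiv.Perm (Fin s))
    (Z : Phase d s) : BoltzCollOp d s g (Z ∘ σ) = BoltzCollOp d s g Z := by
  simp only [boltzCollOp_eq]
  rw [← Equiv.sum_comp σ (fun i => ∫ w, ∫ ω, collTerm g Z i w ω ∂(sphMeas d))]
  refine Finset.sum_congr rfl fun i _ => ?_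
  congr 1
  funext w
  congr 1
  funext ω
  unfold collTerm gainConf lossConf
  rw [update_comp_perm, snoc_comp_perm, snoc_comp_perm, hg, hg]
  rfl

/-! ### Dispersive weights -/

/-- The one-particle Maxwellian with dispersive spatial decay. -/
def gau {d : ℕ} (β t : ℝ) (z : Rd d × Rd d) : ℝ :=
  exp (-(β / 2) * (‖z.2‖ ^ 2 + ‖z.1 - t • z.2‖ ^ 2))

lemma gau_pos {d : ℕ} (β t : ℝ) (z : Rd d × Rd d) : 0 < gau β t z := exp_pos _

lemma gau_le {d : ℕ} {β : ℝ} (hβ : 0 < β) (t : ℝ) (z : Rd d × Rd d) :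
    gau β t z ≤ exp (-(β / 2) * ‖z.2‖ ^ 2) := by
  refine exp_le_exp.mpr ?_
  nlinarith [mul_nonneg (half_pos hβ).le (sq_nonneg ‖z.1 - t • z.2‖)]

lemma gau_flow {d : ℕ} (β t : ℝ) (z : Rd d × Rd d) :
    gau β t (z.1 + t • z.2, z.2) = gau β 0 z := by
  simp [gau]

@[fun_prop]
lemma Continuous.gau {X : Type*} [TopologicalSpace X] {d : ℕ} {β : ℝ} {t : X → ℝ}
    {z : X → Rd d × Rd d} (ht : Continuous t) (hz : Continuous z) :
    Continuous fun x => gau β (t x) (z x) := by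
  unfold _root_.gau
  fun_prop

lemma prod_gau {d s : ℕ} (β t : ℝ) (Z : Phase d s) :
    ∏ i, gau β t (Z i) = exp (-(β * (energy Z + inertiaShift t Z))) := by
  unfold gau energy inertiaShift
  rw [← exp_sum, ← Finset.mul_sum, Finset.sum_add_distrib]
  congr 1
  ring

/-- Conservation of energy and momentum makes products of Maxwellians collision invariant. -/
lemma gau_mul_gau_postcollisional {d : ℕ} (β t : ℝ) (x v w : Rd d)
    (ω : Metric.sphere (0 : Rd d) 1) :
    gau β t (x, v + ⟪(ω : Rd d), w - v⟫_ℝ • (ω : Rd d))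
        * gau β t (x, w - ⟪(ω : Rd d), w - v⟫_ℝ • (ω : Rd d))
      = gau β t (x, v) * gau β t (x, w) := by
  unfold gau
  rw [← exp_add, ← exp_add]
  congr 1
  have hen := norm_sq_postcollisional v w ω
  simp only
  set a := ⟪(ω : Rd d), w - v⟫_ℝ • (ω : Rd d) with ha
  have hsq : ∀ y : Rd d, ‖x - t • y‖ ^ 2 = ‖x‖ ^ 2 - 2 * t * ⟪x, y⟫_ℝ + t ^ 2 * ‖y‖ ^ 2 := by
    intro y
    rw [norm_sub_sq_real, inner_smul_right, norm_smul, mul_pow, Real.norm_eq_abs, sq_abs]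
    ring
  rw [hsq, hsq, hsq, hsq, inner_add_right, inner_sub_right]
  linear_combination (-(β / 2) * (1 + t ^ 2)) * hen

/-- The collision rate against the Maxwellian background. -/
def collRate {d : ℕ} (β t : ℝ) (z : Rd d × Rd d) : ℝ :=
  ∫ w, ‖w - z.2‖ * gau β t (z.1, w)

/-- The collision rate along a free trajectory. -/
def flowRate {d : ℕ} (β t : ℝ) (z : Rd d × Rd d) : ℝ := collRate β t (z.1 + t • z.2, z.2)

/-- A bound for the total number of collisions along a free trajectory. -/
def rateBound (d : ℕ) (β : ℝ) : ℝ := √(π / (β / 2)) * (π / (β / 2)) ^ ((d : ℝ) / 2)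

lemma rateBound_pos (d : ℕ) {β : ℝ} (hβ : 0 < β) : 0 < rateBound d β := by
  unfold rateBound
  have : 0 < π / (β / 2) := by positivity
  exact mul_pos (sqrt_pos.mpr this) (rpow_pos_of_pos this _)

lemma norm_mul_gau_le {d : ℕ} {β : ℝ} (hβ : 0 < β) (t : ℝ) (x v w : Rd d) :
    ‖w - v‖ * gau β t (x, w) ≤ (‖w‖ + ‖v‖) * exp (-(β / 2) * ‖w‖ ^ 2) := by
  have h1 := gau_le hβ t (x, w)
  have h2 := norm_sub_le w v
  exact mul_le_mul h2 h1 (gau_pos _ _ _).le (by positivity)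

lemma integrable_norm_mul_gau {d : ℕ} {β : ℝ} (hβ : 0 < β) (t : ℝ) (x v : Rd d) :
    Integrable fun w => ‖w - v‖ * gau β t (x, w) := by
  refine (integrable_norm_sub_mul_gaussian (b := β / 2) (by positivity) ‖v‖).mono'
    (by fun_prop) (Filter.Eventually.of_forall fun w => ?_)
  rw [Real.norm_of_nonneg (mul_nonneg (norm_nonneg _) (gau_pos _ _ _).le)]
  exact norm_mul_gau_le hβ t x v w

lemma flowRate_nonneg {d : ℕ} (β t : ℝ) (z : Rd d × Rd d) : 0 ≤ flowRate β t z :=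
  integral_nonneg fun _ => mul_nonneg (norm_nonneg _) (gau_pos _ _ _).le

lemma continuous_flowRate {d : ℕ} {β : ℝ} (hβ : 0 < β) (z : Rd d × Rd d) :
    Continuous fun t => flowRate β t z := by
  unfold flowRate collRate
  refine continuous_of_dominated
    (bound := fun w => (‖w‖ + ‖z.2‖) * exp (-(β / 2) * ‖w‖ ^ 2)) ?_ ?_ ?_ ?_
  · intro t
    exact (by fun_prop : Continuous fun w => ‖w - z.2‖ * gau β t (z.1 + t • z.2, w)
      ).aestronglyMeasurable
  · intro t
    refine Filter.Eventually.of_forall fun w => ?_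
    rw [Real.norm_of_nonneg (mul_nonneg (norm_nonneg _) (gau_pos _ _ _).le)]
    exact norm_mul_gau_le hβ t _ _ w
  · exact integrable_norm_sub_mul_gaussian (by positivity) _
  · refine Filter.Eventually.of_forall fun w => ?_
    fun_prop

/-- The time a straight line spends near the origin, weighted by its speed, is bounded. -/
lemma integral_norm_mul_gaussian_line_le {d : ℕ} {b : ℝ} (hb : 0 < b) (x u : Rd d) {t : ℝ}
    (ht : 0 ≤ t) :
    ∫ τ in (0 : ℝ)..t, ‖u‖ * exp (-b * ‖x + τ • u‖ ^ 2) ≤ √(π / b) := by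
  rcases eq_or_ne u 0 with rfl | hu
  · simp
  have ha : 0 < ‖u‖ := norm_pos_iff.mpr hu
  set a := ‖u‖ with hadef
  set c := ⟪u, x⟫_ℝ / a with hc
  have hline : ∀ τ : ℝ, (a * τ + c) ^ 2 ≤ ‖x + τ • u‖ ^ 2 := by
    intro τ
    have h1 := abs_real_inner_le_norm u (x + τ • u)
    have h2 : ⟪u, x + τ • u⟫_ℝ = a * (a * τ + c) := by
      rw [inner_add_right, inner_smul_right, real_inner_self_eq_norm_sq, hc]
      field_simp
      ring
    rw [h2, abs_mul, abs_of_pos ha] at h1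
    have h3 := le_of_mul_le_mul_left h1 ha
    rw [← sq_abs (a * τ + c)]
    gcongr
  calc ∫ τ in (0 : ℝ)..t, a * exp (-b * ‖x + τ • u‖ ^ 2)
      ≤ ∫ τ in (0 : ℝ)..t, a * exp (-b * (a * τ + c) ^ 2) := by
        refine intervalIntegral.integral_mono_on ht (Continuous.intervalIntegrable (by fun_prop) _ _)
          (Continuous.intervalIntegrable (by fun_prop) _ _) fun τ _ => ?_
        refine mul_le_mul_of_nonneg_left (exp_le_exp.mpr ?_) ha.le
        nlinarith [mul_le_mul_of_nonneg_left (hline τ) hb.le]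
    _ = ∫ r in (a * 0 + c)..(a * t + c), exp (-b * r ^ 2) := by
        rw [intervalIntegral.integral_const_mul]
        exact intervalIntegral.mul_integral_comp_mul_add (f := fun r => exp (-b * r ^ 2)) a c
    _ ≤ ∫ r, exp (-b * r ^ 2) := by
        rw [intervalIntegral.integral_of_le (by nlinarith)]
        exact setIntegral_le_integral (integrable_exp_neg_mul_sq hb)
          (Filter.Eventually.of_forall fun r => (exp_pos _).le)
    _ = √(π / b) := integral_gaussian b

lemma integral_flowRate_le {d : ℕ} {β : ℝ} (hβ : 0 < β) (z : Rd d × Rd d) {t : ℝ} (ht : 0 ≤ t) :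
    ∫ τ in (0 : ℝ)..t, flowRate β τ z ≤ rateBound d β := by
  have hb : 0 < β / 2 := half_pos hβ
  set F : ℝ → Rd d → ℝ := fun τ w => ‖w - z.2‖ * gau β τ (z.1 + τ • z.2, w) with hF
  have hFc : Continuous (Function.uncurry F) := by
    simp only [hF, Function.uncurry_def]
    fun_prop
  have hF0 : ∀ τ w, 0 ≤ F τ w := fun τ w => mul_nonneg (norm_nonneg _) (gau_pos _ _ _).le
  have hFint : Integrable (Function.uncurry F)
      ((volume.restrict (Set.Ioc 0 t)).prod volume) := by
    refine Integrable.mono' ((integrable_norm_sub_mul_gaussian (b := β / 2) hb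
      ‖z.2‖).comp_snd (volume.restrict (Set.Ioc 0 t))) hFc.aestronglyMeasurable
      (Filter.Eventually.of_forall fun p => ?_)
    rw [Real.norm_of_nonneg (show 0 ≤ Function.uncurry F p from hF0 p.1 p.2)]
    exact norm_mul_gau_le hβ _ _ _ _
  have hslice : ∀ w, ∫ τ in Set.Ioc 0 t, F τ w
      ≤ √(π / (β / 2)) * exp (-(β / 2) * ‖w‖ ^ 2) := by
    intro w
    rw [← intervalIntegral.integral_of_le ht]
    have e : ∀ τ, F τ w = exp (-(β / 2) * ‖w‖ ^ 2)
        * (‖z.2 - w‖ * exp (-(β / 2) * ‖z.1 + τ • (z.2 - w)‖ ^ 2)) := by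
      intro τ
      simp only [hF, gau]
      rw [mul_add, exp_add, norm_sub_rev w, smul_sub, ← add_sub_assoc]
      ring
    simp_rw [e]
    rw [intervalIntegral.integral_const_mul, mul_comm]
    gcongr
    exact integral_norm_mul_gaussian_line_le hb _ _ ht
  calc ∫ τ in (0 : ℝ)..t, flowRate β τ z
      = ∫ τ in Set.Ioc 0 t, ∫ w, F τ w := intervalIntegral.integral_of_le ht
    _ = ∫ w, ∫ τ in Set.Ioc 0 t, F τ w := integral_integral_swap hFint
    _ ≤ ∫ w : Rd d, √(π / (β / 2)) * exp (-(β / 2) * ‖w‖ ^ 2) :=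
        integral_mono hFint.integral_prod_right ((integrable_gaussian hb).const_mul _) hslice
    _ = rateBound d β := by
        rw [integral_const_mul, GaussianFourier.integral_rexp_neg_mul_sq_norm hb, rateBound,
          finrank_euclideanSpace_fin]

/-- The amplification factor along a free trajectory: it increases from `1` to at most `2`,
at the speed of the collision rate. -/
def ampl {d : ℕ} (β t : ℝ) (z : Rd d × Rd d) : ℝ :=
  1 + (∫ τ in (0 : ℝ)..t, flowRate β τ z) / rateBound d β

lemma one_le_ampl {d : ℕ} {β : ℝ} (hβ : 0 < β) (z : Rd d × Rd d) {t : ℝ} (ht : 0 ≤ t) :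
    1 ≤ ampl β t z := by
  have := intervalIntegral.integral_nonneg (μ := volume) ht fun τ _ => flowRate_nonneg β τ z
  have := div_nonneg this (rateBound_pos d hβ).le
  unfold ampl
  linarith

lemma ampl_le_two {d : ℕ} {β : ℝ} (hβ : 0 < β) (z : Rd d × Rd d) {t : ℝ} (ht : 0 ≤ t) :
    ampl β t z ≤ 2 := by
  have := (div_le_one (rateBound_pos d hβ)).mpr (integral_flowRate_le hβ z ht)
  unfold ampl
  linarith

lemma hasDerivAt_ampl {d : ℕ} {β : ℝ} (hβ : 0 < β) (z : Rd d × Rd d) (t : ℝ) :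
    HasDerivAt (fun t => ampl β t z) (flowRate β t z / rateBound d β) t := by
  have hc := continuous_flowRate hβ z
  exact ((intervalIntegral.integral_hasDerivAt_right (hc.intervalIntegrable _ _)
    (hc.stronglyMeasurableAtFilter _ _) hc.continuousAt).div_const _).const_add _

/-- The one-particle weight with fugacity `k`. -/
def oneWeight {d : ℕ} (β k t : ℝ) (z : Rd d × Rd d) : ℝ :=
  k * ampl β t (z.1 - t • z.2, z.2) * gau β t z

/-- The `s`-particle weight. -/
def weight {d s : ℕ} (β k t : ℝ) (Z : Phase d s) : ℝ := ∏ i, oneWeight β k t (Z i)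

lemma oneWeight_nonneg {d : ℕ} {β k t : ℝ} (hβ : 0 < β) (hk : 0 < k) (ht : 0 ≤ t)
    (z : Rd d × Rd d) : 0 ≤ oneWeight β k t z := by
  have := one_le_ampl hβ (z.1 - t • z.2, z.2) ht
  have := gau_pos β t z
  unfold oneWeight
  positivity

lemma oneWeight_le {d : ℕ} {β k t : ℝ} (hβ : 0 < β) (hk : 0 < k) (ht : 0 ≤ t)
    (z : Rd d × Rd d) : oneWeight β k t z ≤ 2 * k * gau β t z := by
  have h1 := ampl_le_two hβ (z.1 - t • z.2, z.2) ht
  have h2 := gau_pos β t z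
  unfold oneWeight
  rw [mul_comm 2 k]
  gcongr

lemma le_oneWeight {d : ℕ} {β k t : ℝ} (hβ : 0 < β) (hk : 0 < k) (ht : 0 ≤ t)
    (z : Rd d × Rd d) : k * gau β t z ≤ oneWeight β k t z := by
  have h1 := one_le_ampl hβ (z.1 - t • z.2, z.2) ht
  have h2 := gau_pos β t z
  unfold oneWeight
  refine mul_le_mul_of_nonneg_right ?_ h2.le
  nlinarith

lemma oneWeight_flow {d : ℕ} (β k t : ℝ) (z : Rd d × Rd d) :
    oneWeight β k t (z.1 + t • z.2, z.2) = k * ampl β t z * gau β 0 z := by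
  unfold oneWeight
  rw [gau_flow]
  simp

lemma weight_nonneg {d s : ℕ} {β k t : ℝ} (hβ : 0 < β) (hk : 0 < k) (ht : 0 ≤ t)
    (Z : Phase d s) : 0 ≤ weight β k t Z :=
  Finset.prod_nonneg fun _ _ => oneWeight_nonneg hβ hk ht _

lemma weight_le {d s : ℕ} {β k t : ℝ} (hβ : 0 < β) (hk : 0 < k) (ht : 0 ≤ t)
    (Z : Phase d s) : weight β k t Z ≤ (2 * k) ^ s * ∏ i, gau β t (Z i) := by
  calc weight β k t Z ≤ ∏ i, (2 * k * gau β t (Z i)) :=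
        Finset.prod_le_prod (fun _ _ => oneWeight_nonneg hβ hk ht _)
          fun _ _ => oneWeight_le hβ hk ht _
    _ = _ := by rw [Finset.prod_mul_distrib]; simp

lemma le_weight {d s : ℕ} {β k t : ℝ} (hβ : 0 < β) (hk : 0 < k) (ht : 0 ≤ t)
    (Z : Phase d s) : k ^ s * ∏ i, gau β t (Z i) ≤ weight β k t Z := by
  calc k ^ s * ∏ i, gau β t (Z i) = ∏ i, (k * gau β t (Z i)) := by
        rw [Finset.prod_mul_distrib]; simp
    _ ≤ weight β k t Z :=
        Finset.prod_le_prod (fun _ _ => (mul_pos hk (gau_pos _ _ _)).le)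
          fun _ _ => le_oneWeight hβ hk ht _

lemma prod_gau_le_energy {d s : ℕ} {β : ℝ} (hβ : 0 < β) (t : ℝ) (Z : Phase d s) :
    ∏ i, gau β t (Z i) ≤ exp (-β * energy Z) := by
  rw [prod_gau]
  refine exp_le_exp.mpr ?_
  have : 0 ≤ inertiaShift t Z := by unfold inertiaShift; positivity
  nlinarith [mul_nonneg hβ.le this]

lemma weight_le_energy {d s : ℕ} {β k t : ℝ} (hβ : 0 < β) (hk : 0 < k) (ht : 0 ≤ t)
    (Z : Phase d s) : weight β k t Z ≤ (2 * k) ^ s * exp (-β * energy Z) :=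
  (weight_le hβ hk ht Z).trans
    (mul_le_mul_of_nonneg_left (prod_gau_le_energy hβ t Z) (by positivity))

lemma weight_gainConf_le {d s : ℕ} {β k t : ℝ} (hβ : 0 < β) (hk : 0 < k) (ht : 0 ≤ t)
    (Z : Phase d s) (i : Fin s) (w : Rd d) (ω : Metric.sphere (0 : Rd d) 1) :
    weight β k t (gainConf Z i w ω) ≤ 4 * k ^ 2 * gau β t (Z i) *
      (∏ j ∈ Finset.univ.erase i, oneWeight β k t (Z j)) * gau β t ((Z i).1, w) := by
  unfold weight gainConf
  rw [Fin.prod_univ_castSucc]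
  simp only [Fin.snoc_castSucc, Fin.snoc_last]
  rw [← Finset.mul_prod_erase _ _ (Finset.mem_univ i), Function.update_self]
  have hrest : ∏ j ∈ Finset.univ.erase i, oneWeight β k t (Function.update Z i
      ((Z i).1, (Z i).2 + ⟪(ω : Rd d), w - (Z i).2⟫_ℝ • (ω : Rd d)) j)
      = ∏ j ∈ Finset.univ.erase i, oneWeight β k t (Z j) := by
    refine Finset.prod_congr rfl fun j hj => ?_
    rw [Function.update_of_ne (Finset.ne_of_mem_erase hj)]
  rw [hrest]
  set P := ∏ j ∈ Finset.univ.erase i, oneWeight β k t (Z j)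
  have hP : 0 ≤ P := Finset.prod_nonneg fun _ _ => oneWeight_nonneg hβ hk ht _
  set z' : Rd d × Rd d := ((Z i).1, (Z i).2 + ⟪(ω : Rd d), w - (Z i).2⟫_ℝ • (ω : Rd d)) with hz'
  set z'' : Rd d × Rd d := ((Z i).1, w - ⟪(ω : Rd d), w - (Z i).2⟫_ℝ • (ω : Rd d)) with hz''
  have hinv : gau β t z' * gau β t z'' = gau β t (Z i) * gau β t ((Z i).1, w) :=
    gau_mul_gau_postcollisional β t (Z i).1 (Z i).2 w ω
  have hmul : oneWeight β k t z' * oneWeight β k t z''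
      ≤ (2 * k * gau β t z') * (2 * k * gau β t z'') :=
    mul_le_mul (oneWeight_le hβ hk ht _) (oneWeight_le hβ hk ht _) (oneWeight_nonneg hβ hk ht _)
      (mul_nonneg (by positivity) (gau_pos _ _ _).le)
  calc oneWeight β k t z' * P * oneWeight β k t z''
      = oneWeight β k t z' * oneWeight β k t z'' * P := by ring
    _ ≤ (2 * k * gau β t z') * (2 * k * gau β t z'') * P := by gcongr
    _ = 4 * k ^ 2 * (gau β t z' * gau β t z'') * P := by ring
    _ = _ := by rw [hinv]; ring

lemma weight_lossConf_le {d s : ℕ} {β k t : ℝ} (hβ : 0 < β) (hk : 0 < k) (ht : 0 ≤ t)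
    (Z : Phase d s) (i : Fin s) (w : Rd d) :
    weight β k t (lossConf Z i w) ≤ 4 * k ^ 2 * gau β t (Z i) *
      (∏ j ∈ Finset.univ.erase i, oneWeight β k t (Z j)) * gau β t ((Z i).1, w) := by
  unfold weight lossConf
  rw [Fin.prod_univ_castSucc]
  simp only [Fin.snoc_castSucc, Fin.snoc_last]
  rw [← Finset.mul_prod_erase _ _ (Finset.mem_univ i)]
  set P := ∏ j ∈ Finset.univ.erase i, oneWeight β k t (Z j)
  have hP : 0 ≤ P := Finset.prod_nonneg fun _ _ => oneWeight_nonneg hβ hk ht _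
  have hmul : oneWeight β k t (Z i) * oneWeight β k t ((Z i).1, w)
      ≤ (2 * k * gau β t (Z i)) * (2 * k * gau β t ((Z i).1, w)) :=
    mul_le_mul (oneWeight_le hβ hk ht _) (oneWeight_le hβ hk ht _) (oneWeight_nonneg hβ hk ht _)
      (mul_nonneg (by positivity) (gau_pos _ _ _).le)
  calc oneWeight β k t (Z i) * P * oneWeight β k t ((Z i).1, w)
      = oneWeight β k t (Z i) * oneWeight β k t ((Z i).1, w) * P := by ring
    _ ≤ (2 * k * gau β t (Z i)) * (2 * k * gau β t ((Z i).1, w)) * P := by gcongr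
    _ = _ := by ring

/-- The collision operator applied to a function dominated by the weight. -/
lemma abs_boltzCollOp_le {d s : ℕ} {β k t N : ℝ} (hβ : 0 < β) (hk : 0 < k) (ht : 0 ≤ t)
    (hN : 0 ≤ N) {g : Phase d (s + 1) → ℝ} (hg : ∀ Z, |g Z| ≤ N * weight β k t Z)
    (Z : Phase d s) :
    |BoltzCollOp d s g Z| ≤ ∑ i, sphArea d * N * (4 * k ^ 2 * gau β t (Z i) *
      ∏ j ∈ Finset.univ.erase i, oneWeight β k t (Z j)) * collRate β t (Z i) := by
  rw [boltzCollOp_eq]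
  refine (Finset.abs_sum_le_sum_abs _ _).trans (Finset.sum_le_sum fun i _ => ?_)
  set B := 4 * k ^ 2 * gau β t (Z i) * ∏ j ∈ Finset.univ.erase i, oneWeight β k t (Z j) with hB
  have hle := norm_integral_le_of_norm_le
    (f := fun w => ∫ ω, collTerm g Z i w ω ∂(sphMeas d))
    ((integrable_norm_mul_gau hβ t (Z i).1 (Z i).2).const_mul (sphArea d * N * B))
    (Filter.Eventually.of_forall fun w => ?_)
  · rwa [integral_const_mul] at hle
  · refine (abs_integral_sphere_collTerm_le (B := N * (B * gau β t ((Z i).1, w))) ?_ ?_).trans_eq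
      (by ring)
    · exact fun ω => (hg _).trans
        (mul_le_mul_of_nonneg_left (weight_gainConf_le hβ hk ht Z i w ω) hN)
    · exact (hg _).trans (mul_le_mul_of_nonneg_left (weight_lossConf_le hβ hk ht Z i w) hN)

/-- Along the free flow the collision operator is controlled by the growth of the weight. -/
lemma abs_boltzCollOp_freeFlow_le {d s : ℕ} {β k t N : ℝ} (hβ : 0 < β) (hk : 0 < k) (ht : 0 ≤ t)
    (hN : 0 ≤ N) {g : Phase d (s + 1) → ℝ} (hg : ∀ Z, |g Z| ≤ N * weight β k t Z)
    (Z : Phase d s) :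
    |BoltzCollOp d s g (freeFlow t Z)| ≤ 4 * sphArea d * k * rateBound d β * N *
      (∏ j, k * gau β 0 (Z j)) * ∑ i, (∏ j ∈ Finset.univ.erase i, ampl β t (Z j)) *
        (flowRate β t (Z i) / rateBound d β) := by
  refine (abs_boltzCollOp_le hβ hk ht hN hg _).trans_eq ?_
  rw [Finset.mul_sum]
  refine Finset.sum_congr rfl fun i _ => ?_
  have hflow : ∀ j, freeFlow t Z j = ((Z j).1 + t • (Z j).2, (Z j).2) := fun _ => rfl
  simp only [hflow, gau_flow, oneWeight_flow]
  change _ * flowRate β t (Z i) = _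
  rw [← Finset.mul_prod_erase _ (fun j => k * gau β 0 (Z j)) (Finset.mem_univ i)]
  have hsplit : ∏ j ∈ Finset.univ.erase i, k * ampl β t (Z j) * gau β 0 (Z j)
      = (∏ j ∈ Finset.univ.erase i, k * gau β 0 (Z j))
        * ∏ j ∈ Finset.univ.erase i, ampl β t (Z j) := by
    rw [← Finset.prod_mul_distrib]
    exact Finset.prod_congr rfl fun j _ => by ring
  rw [hsplit]
  have := (rateBound_pos d hβ).ne'
  field_simp

/-- The Duhamel operator halves the weighted norm under the smallness condition. -/
lemma abs_duhamel_le {d s : ℕ} {β k ℓ N : ℝ} (hβ : 0 < β) (hk : 0 < k) (hℓ : 0 < ℓ)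
    (hN : 0 ≤ N) (hsmall : ℓ⁻¹ * (4 * sphArea d * k * rateBound d β) ≤ 1 / 2)
    {g : ℝ → Phase d (s + 1) → ℝ} (hg : ∀ t, 0 ≤ t → ∀ Z, |g t Z| ≤ N * weight β k t Z)
    {t : ℝ} (ht : 0 ≤ t) (Z : Phase d s) :
    |∫ τ in (0 : ℝ)..t, ℓ⁻¹ * BoltzCollOp d s (g τ) (freeFlow τ Z)|
      ≤ N / 2 * weight β k t (freeFlow t Z) := by
  set G := ∏ j, k * gau β 0 (Z j) with hG
  have hG0 : 0 ≤ G := Finset.prod_nonneg fun _ _ => (mul_pos hk (gau_pos _ _ _)).le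
  set D : ℝ → ℝ := fun τ => ∑ i, (∏ j ∈ Finset.univ.erase i, ampl β τ (Z j)) *
        (flowRate β τ (Z i) / rateBound d β) with hD
  have hampl : ∀ z : Rd d × Rd d, Continuous fun τ => ampl β τ z := fun z =>
    continuous_iff_continuousAt.mpr fun τ => (hasDerivAt_ampl hβ z τ).continuousAt
  have hDc : Continuous D := by
    refine continuous_finsetSum _ fun i _ => Continuous.mul ?_ ?_
    · exact continuous_finsetProd _ fun j _ => hampl _
    · exact (continuous_flowRate hβ _).div_const _
  have hderiv : ∀ τ, HasDerivAt (fun τ => ∏ j, ampl β τ (Z j)) (D τ) τ := by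
    intro τ
    have := HasDerivAt.fun_finsetProd (u := Finset.univ) (x := τ)
      (f := fun j τ => ampl β τ (Z j)) fun j _ => hasDerivAt_ampl hβ (Z j) τ
    simpa [hD] using this
  have hD0 : ∀ τ, 0 ≤ τ → 0 ≤ D τ := fun τ hτ =>
    Finset.sum_nonneg fun i _ => mul_nonneg
      (Finset.prod_nonneg fun j _ => zero_le_one.trans (one_le_ampl hβ _ hτ))
      (div_nonneg (flowRate_nonneg _ _ _) (rateBound_pos d hβ).le)
  have hle := intervalIntegral.norm_integral_le_of_norm_le (μ := volume)
    (f := fun τ => ℓ⁻¹ * BoltzCollOp d s (g τ) (freeFlow τ Z))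
    (g := fun τ => N / 2 * G * D τ) ht
    (Filter.Eventually.of_forall fun τ hτ => ?_)
    ((continuous_const.mul hDc).intervalIntegrable _ _)
  · refine hle.trans ?_
    rw [intervalIntegral.integral_const_mul, intervalIntegral.integral_eq_sub_of_hasDerivAt
      (fun τ _ => hderiv τ) (hDc.intervalIntegrable _ _)]
    have hw : weight β k t (freeFlow t Z) = G * ∏ j, ampl β t (Z j) := by
      unfold weight freeFlow
      simp only [oneWeight_flow]
      rw [hG, ← Finset.prod_mul_distrib]
      exact Finset.prod_congr rfl fun j _ => by ring
    rw [hw, mul_assoc]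
    have h1 : 0 ≤ ∏ j, ampl β 0 (Z j) :=
      Finset.prod_nonneg fun j _ => zero_le_one.trans (one_le_ampl hβ _ le_rfl)
    gcongr
    linarith
  · rw [Real.norm_eq_abs, abs_mul, abs_of_pos (inv_pos.mpr hℓ)]
    calc ℓ⁻¹ * |BoltzCollOp d s (g τ) (freeFlow τ Z)|
        ≤ ℓ⁻¹ * (4 * sphArea d * k * rateBound d β * N * G * D τ) :=
          mul_le_mul_of_nonneg_left
            (abs_boltzCollOp_freeFlow_le hβ hk hτ.1.le hN (hg τ hτ.1.le) Z)
            (inv_pos.mpr hℓ).le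
      _ = ℓ⁻¹ * (4 * sphArea d * k * rateBound d β) * (N * G * D τ) := by ring
      _ ≤ 1 / 2 * (N * G * D τ) := by
          have := hD0 τ hτ.1.le
          gcongr
      _ = N / 2 * G * D τ := by ring

/-! ### The mild formulation and its fixed point -/

/-- Continuous families of densities, extended constantly to negative times, that are controlled
by a multiple of the weight. -/
structure Admissible {d : ℕ} (β k N : ℝ) (f : (s : ℕ) → ℝ → Phase d s → ℝ) : Prop where
  nonneg : 0 ≤ N
  continuous : ∀ s, Continuous (Function.uncurry (f s))
  bound : ∀ s, 1 ≤ s → ∀ t, 0 ≤ t → ∀ Z, |f s t Z| ≤ N * weight β k t Z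
  max_zero : ∀ s t Z, f s (max t 0) Z = f s t Z

/-- The Duhamel term of the hierarchy. -/
def duhamel {d : ℕ} (ℓ : ℝ) (f : (s : ℕ) → ℝ → Phase d s → ℝ) (s : ℕ) (t : ℝ)
    (Z : Phase d s) : ℝ :=
  ∫ τ in (0 : ℝ)..max t 0,
    ℓ⁻¹ * BoltzCollOp d s (f (s + 1) τ) (freeFlow τ (freeFlow (-max t 0) Z))

/-- The solution of the free transport equation. -/
def freeTransport {d : ℕ} (f₀ : (s : ℕ) → Phase d s → ℝ) (s : ℕ) (t : ℝ) (Z : Phase d s) : ℝ :=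
  f₀ s (freeFlow (-max t 0) Z)

namespace Admissible

variable {d : ℕ} {β k N : ℝ} {f : (s : ℕ) → ℝ → Phase d s → ℝ}

lemma abs_le_energy (hf : Admissible β k N f) (hβ : 0 < β) (hk : 0 < k) (s : ℕ) (t : ℝ)
    (Z : Phase d (s + 1)) :
    |f (s + 1) t Z| ≤ N * (2 * k) ^ (s + 1) * exp (-β * energy Z) := by
  rw [← hf.max_zero, mul_assoc]
  exact (hf.bound _ (Nat.le_add_left 1 s) _ (le_max_right t 0) Z).trans
    (mul_le_mul_of_nonneg_left (weight_le_energy hβ hk (le_max_right t 0) Z) hf.nonneg)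

lemma continuous_collision (hf : Admissible β k N f) (hβ : 0 < β) (hk : 0 < k) (ℓ : ℝ) (s : ℕ) :
    Continuous (Function.uncurry fun t Z => ℓ⁻¹ * BoltzCollOp d s (f (s + 1) t) Z) :=
  continuous_const.mul (continuous_boltzCollOp hβ (hf.continuous (s + 1)) fun t Z =>
    hf.abs_le_energy hβ hk s t Z)

lemma continuous_duhamel (hf : Admissible β k N f) (hβ : 0 < β) (hk : 0 < k) (ℓ : ℝ) (s : ℕ) :
    Continuous (Function.uncurry (duhamel ℓ f s)) := by
  refine intervalIntegral.continuous_parametric_intervalIntegral_of_continuous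
    (f := fun (p : ℝ × Phase d s) τ =>
      ℓ⁻¹ * BoltzCollOp d s (f (s + 1) τ) (freeFlow τ (freeFlow (-max p.1 0) p.2))) ?_ (by fun_prop)
  exact (hf.continuous_collision hβ hk ℓ s).comp (f := fun q : (ℝ × Phase d s) × ℝ =>
    (q.2, freeFlow q.2 (freeFlow (-max q.1.1 0) q.1.2))) (by fun_prop)

end Admissible

lemma duhamel_max_zero {d : ℕ} (ℓ : ℝ) (f : (s : ℕ) → ℝ → Phase d s → ℝ) (s : ℕ) (t : ℝ)
    (Z : Phase d s) : duhamel ℓ f s (max t 0) Z = duhamel ℓ f s t Z := by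
  simp [duhamel]

lemma duhamel_comp_perm {d : ℕ} {ℓ : ℝ} {f : (s : ℕ) → ℝ → Phase d s → ℝ} {s : ℕ}
    (hf : ∀ σ : Equiv.Perm (Fin (s + 1)), ∀ t Z, f (s + 1) t (Z ∘ σ) = f (s + 1) t Z)
    (σ : Equiv.Perm (Fin s)) (t : ℝ) (Z : Phase d s) :
    duhamel ℓ f s t (Z ∘ σ) = duhamel ℓ f s t Z := by
  unfold duhamel
  simp only [freeFlow_comp]
  simp only [boltzCollOp_comp_perm fun σ Z => hf σ _ Z]

lemma abs_duhamel_le_weight {d : ℕ} {β k ℓ N : ℝ} (hβ : 0 < β) (hk : 0 < k) (hℓ : 0 < ℓ)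
    (hN : 0 ≤ N) (hsmall : ℓ⁻¹ * (4 * sphArea d * k * rateBound d β) ≤ 1 / 2)
    {f : (s : ℕ) → ℝ → Phase d s → ℝ}
    (hf : ∀ s, 1 ≤ s → ∀ t, 0 ≤ t → ∀ Z, |f s t Z| ≤ N * weight β k t Z)
    (s : ℕ) {t : ℝ} (ht : 0 ≤ t) (Z : Phase d s) :
    |duhamel ℓ f s t Z| ≤ N / 2 * weight β k t Z := by
  have h := abs_duhamel_le hβ hk hℓ hN hsmall (hf (s + 1) (Nat.le_add_left 1 s)) ht
    (freeFlow (-t) Z)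
  rw [freeFlow_add t, neg_add_cancel, freeFlow_zero] at h
  rwa [duhamel, max_eq_left ht]

lemma duhamel_sub {d : ℕ} {β k N M : ℝ} (hβ : 0 < β) (hk : 0 < k) (ℓ : ℝ)
    {f g : (s : ℕ) → ℝ → Phase d s → ℝ} (hf : Admissible β k N f) (hg : Admissible β k M g)
    (s : ℕ) (t : ℝ) (Z : Phase d s) :
    duhamel ℓ f s t Z - duhamel ℓ g s t Z = duhamel ℓ (fun s t Z => f s t Z - g s t Z) s t Z := by
  have hc : ∀ {h : (s : ℕ) → ℝ → Phase d s → ℝ} {K : ℝ}, Admissible β k K h →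
      Continuous fun τ => ℓ⁻¹ *
        BoltzCollOp d s (h (s + 1) τ) (freeFlow τ (freeFlow (-max t 0) Z)) := fun hh =>
    (hh.continuous_collision hβ hk ℓ s).comp
      (f := fun τ => (τ, freeFlow τ (freeFlow (-max t 0) Z))) (by fun_prop)
  unfold duhamel
  rw [← intervalIntegral.integral_sub ((hc hf).intervalIntegrable _ _)
    ((hc hg).intervalIntegrable _ _)]
  congr 1
  funext τ
  rw [← mul_sub]
  exact congrArg (ℓ⁻¹ * ·) (boltzCollOp_sub hβ
    ((hf.continuous (s + 1)).comp (Continuous.prodMk_right τ))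
    ((hg.continuous (s + 1)).comp (Continuous.prodMk_right τ))
    (hf.abs_le_energy hβ hk s τ) (hg.abs_le_energy hβ hk s τ) _).symm

lemma abs_duhamel_sub_le {d : ℕ} {β k ℓ N M K : ℝ} (hβ : 0 < β) (hk : 0 < k) (hℓ : 0 < ℓ)
    (hsmall : ℓ⁻¹ * (4 * sphArea d * k * rateBound d β) ≤ 1 / 2)
    {f g : (s : ℕ) → ℝ → Phase d s → ℝ} (hf : Admissible β k N f) (hg : Admissible β k M g)
    (hK : 0 ≤ K)
    (hfg : ∀ s, 1 ≤ s → ∀ t, 0 ≤ t → ∀ Z, |f s t Z - g s t Z| ≤ K * weight β k t Z)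
    (s : ℕ) {t : ℝ} (ht : 0 ≤ t) (Z : Phase d s) :
    |duhamel ℓ f s t Z - duhamel ℓ g s t Z| ≤ K / 2 * weight β k t Z := by
  rw [duhamel_sub hβ hk ℓ hf hg]
  exact abs_duhamel_le_weight hβ hk hℓ hK hsmall hfg s ht Z

lemma eq_of_mild {d : ℕ} {β k ℓ N M : ℝ} (hβ : 0 < β) (hk : 0 < k) (hℓ : 0 < ℓ)
    (hsmall : ℓ⁻¹ * (4 * sphArea d * k * rateBound d β) ≤ 1 / 2)
    {f₀ : (s : ℕ) → Phase d s → ℝ} {f g : (s : ℕ) → ℝ → Phase d s → ℝ}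
    (hf : Admissible β k N f) (hg : Admissible β k M g)
    (hfm : ∀ s, 1 ≤ s → ∀ t, 0 ≤ t → ∀ Z, f s t Z = freeTransport f₀ s t Z + duhamel ℓ f s t Z)
    (hgm : ∀ s, 1 ≤ s → ∀ t, 0 ≤ t → ∀ Z, g s t Z = freeTransport f₀ s t Z + duhamel ℓ g s t Z)
    {s : ℕ} (hs : 1 ≤ s) {t : ℝ} (ht : 0 ≤ t) (Z : Phase d s) : f s t Z = g s t Z := by
  have hdec : ∀ n : ℕ, ∀ s, 1 ≤ s → ∀ t, 0 ≤ t → ∀ Z : Phase d s,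
      |f s t Z - g s t Z| ≤ (N + M) / 2 ^ n * weight β k t Z := by
    intro n
    induction n with
    | zero =>
      intro s hs t ht Z
      have h := (abs_sub (f s t Z) (g s t Z)).trans
        (add_le_add (hf.bound s hs t ht Z) (hg.bound s hs t ht Z))
      rw [pow_zero, div_one]
      linarith
    | succ n ih =>
      intro s hs t ht Z
      have hNM : 0 ≤ (N + M) / 2 ^ n := div_nonneg (add_nonneg hf.nonneg hg.nonneg) (by positivity)
      have h := abs_duhamel_sub_le hβ hk hℓ hsmall hf hg hNM ih s ht Z
      rw [hfm s hs t ht Z, hgm s hs t ht Z, add_sub_add_left_eq_sub, pow_succ, ← div_div]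
      exact h
  have hlim : Filter.Tendsto (fun n : ℕ => (N + M) / 2 ^ n * weight β k t Z) Filter.atTop
      (nhds 0) := by
    have := (tendsto_pow_atTop_nhds_zero_of_lt_one (r := (1 / 2 : ℝ)) (by norm_num)
      (by norm_num)).const_mul ((N + M) * weight β k t Z)
    rw [mul_zero] at this
    refine this.congr fun n => ?_
    rw [one_div, inv_pow]
    ring
  have h0 := ge_of_tendsto' hlim fun n => hdec n s hs t ht Z
  exact sub_eq_zero.mp (abs_nonpos_iff.mp h0)

/-- The Picard iterates of the mild formulation. -/
def picard {d : ℕ} (ℓ : ℝ) (f₀ : (s : ℕ) → Phase d s → ℝ) :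
    ℕ → (s : ℕ) → ℝ → Phase d s → ℝ
  | 0 => freeTransport f₀
  | n + 1 => fun s t Z => freeTransport f₀ s t Z + duhamel ℓ (picard ℓ f₀ n) s t Z

lemma continuous_freeTransport {d : ℕ} {f₀ : (s : ℕ) → Phase d s → ℝ}
    (hc : ∀ s, Continuous (f₀ s)) (s : ℕ) :
    Continuous (Function.uncurry (freeTransport f₀ s)) :=
  (hc s).comp (f := fun p : ℝ × Phase d s => freeFlow (-max p.1 0) p.2) (by fun_prop)

lemma picard_comp_perm {d : ℕ} {ℓ : ℝ} {f₀ : (s : ℕ) → Phase d s → ℝ}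
    (hsymm : ∀ s, ∀ σ : Equiv.Perm (Fin s), ∀ Z, f₀ s (Z ∘ σ) = f₀ s Z) (n : ℕ) :
    ∀ s, ∀ σ : Equiv.Perm (Fin s), ∀ t Z,
      picard ℓ f₀ n s t (Z ∘ σ) = picard ℓ f₀ n s t Z := by
  have h0 : ∀ s, ∀ σ : Equiv.Perm (Fin s), ∀ t Z,
      freeTransport f₀ s t (Z ∘ σ) = freeTransport f₀ s t Z := fun s σ t Z => by
    rw [freeTransport, freeFlow_comp, hsymm, freeTransport]
  induction n with
  | zero => exact h0
  | succ n ih =>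
    intro s σ t Z
    simp only [picard, h0, duhamel_comp_perm (ih (s + 1))]

lemma admissible_picard {d : ℕ} {β k ℓ : ℝ} (hβ : 0 < β) (hk : 0 < k) (hℓ : 0 < ℓ)
    (hsmall : ℓ⁻¹ * (4 * sphArea d * k * rateBound d β) ≤ 1 / 2)
    {f₀ : (s : ℕ) → Phase d s → ℝ} (hc : ∀ s, Continuous (f₀ s))
    (h0 : ∀ s, 1 ≤ s → ∀ t, 0 ≤ t → ∀ Z, |freeTransport f₀ s t Z| ≤ weight β k t Z) (n : ℕ) :
    Admissible β k 2 (picard ℓ f₀ n) := by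
  induction n with
  | zero =>
    refine ⟨zero_le_two, continuous_freeTransport hc, fun s hs t ht Z => ?_, fun s t Z => ?_⟩
    · have := weight_nonneg hβ hk ht Z
      exact (h0 s hs t ht Z).trans (by linarith)
    · simp [picard, freeTransport]
  | succ n ih =>
    refine ⟨zero_le_two, fun s => (continuous_freeTransport hc s).add
      (ih.continuous_duhamel hβ hk ℓ s), fun s hs t ht Z => ?_, fun s t Z => ?_⟩
    · have h1 := abs_duhamel_le_weight hβ hk hℓ zero_le_two hsmall ih.bound s ht Z
      have h2 := abs_add_le (freeTransport f₀ s t Z) (duhamel ℓ (picard ℓ f₀ n) s t Z)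
      have h3 := h0 s hs t ht Z
      rw [picard]
      linarith
    · simp [picard, duhamel_max_zero, freeTransport]

lemma abs_picard_sub_le {d : ℕ} {β k ℓ : ℝ} (hβ : 0 < β) (hk : 0 < k) (hℓ : 0 < ℓ)
    (hsmall : ℓ⁻¹ * (4 * sphArea d * k * rateBound d β) ≤ 1 / 2)
    {f₀ : (s : ℕ) → Phase d s → ℝ} (hc : ∀ s, Continuous (f₀ s))
    (h0 : ∀ s, 1 ≤ s → ∀ t, 0 ≤ t → ∀ Z, |freeTransport f₀ s t Z| ≤ weight β k t Z) (n : ℕ) :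
    ∀ s t, 0 ≤ t → ∀ Z, |picard ℓ f₀ n s t Z - picard ℓ f₀ (n + 1) s t Z|
      ≤ 1 / 2 ^ n * weight β k t Z := by
  have hadm := admissible_picard hβ hk hℓ hsmall hc h0
  induction n with
  | zero =>
    intro s t ht Z
    have h := abs_duhamel_le_weight hβ hk hℓ zero_le_two hsmall (hadm 0).bound s ht Z
    rw [abs_sub_comm]
    simpa [picard] using h
  | succ n ih =>
    intro s t ht Z
    have h := abs_duhamel_sub_le hβ hk hℓ hsmall (hadm n) (hadm (n + 1)) (by positivity)
      (fun s _ => ih s) s ht Z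
    rw [picard, picard, add_sub_add_left_eq_sub, pow_succ, ← div_div]
    exact h

/-- The limit of the Picard iterates solves the mild formulation. -/
lemma exists_mild {d : ℕ} {β k ℓ : ℝ} (hβ : 0 < β) (hk : 0 < k) (hℓ : 0 < ℓ)
    (hsmall : ℓ⁻¹ * (4 * sphArea d * k * rateBound d β) ≤ 1 / 2)
    {f₀ : (s : ℕ) → Phase d s → ℝ} (hc : ∀ s, Continuous (f₀ s))
    (hsymm : ∀ s, ∀ σ : Equiv.Perm (Fin s), ∀ Z, f₀ s (Z ∘ σ) = f₀ s Z)
    (h0 : ∀ s, 1 ≤ s → ∀ t, 0 ≤ t → ∀ Z, |freeTransport f₀ s t Z| ≤ weight β k t Z) :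
    ∃ f : (s : ℕ) → ℝ → Phase d s → ℝ, Admissible β k 2 f ∧
      (∀ s, ∀ σ : Equiv.Perm (Fin s), ∀ t Z, f s t (Z ∘ σ) = f s t Z) ∧
      ∀ s t, 0 ≤ t → ∀ Z, f s t Z = freeTransport f₀ s t Z + duhamel ℓ f s t Z := by
  have hadm := admissible_picard hβ hk hℓ hsmall hc h0
  have hstep : ∀ s t (Z : Phase d s), ∀ n, dist (picard ℓ f₀ n s t Z) (picard ℓ f₀ (n + 1) s t Z)
      ≤ 2 * weight β k (max t 0) Z / 2 / 2 ^ n := by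
    intro s t Z n
    have h := abs_picard_sub_le hβ hk hℓ hsmall hc h0 n s (max t 0) (le_max_right t 0) Z
    rw [(hadm n).max_zero, (hadm (n + 1)).max_zero] at h
    rw [Real.dist_eq]
    exact h.trans_eq (by ring)
  choose f hf using fun s t Z =>
    cauchySeq_tendsto_of_complete (cauchySeq_of_le_geometric_two (hstep s t Z))
  have hdist : ∀ s t (Z : Phase d s), ∀ n, |picard ℓ f₀ n s t Z - f s t Z|
      ≤ 2 / 2 ^ n * weight β k (max t 0) Z := fun s t Z n =>
    (dist_le_of_le_geometric_two_of_tendsto (hstep s t Z) (hf s t Z) n).trans_eq (by ring)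
  have hgeom : ∀ C : ℝ, Filter.Tendsto (fun n : ℕ => 2 / 2 ^ n * C) Filter.atTop (nhds 0) := by
    intro C
    have := (tendsto_pow_atTop_nhds_zero_of_lt_one (r := (1 / 2 : ℝ)) (by norm_num)
      (by norm_num)).const_mul (2 * C)
    rw [mul_zero] at this
    refine this.congr fun n => ?_
    rw [one_div, inv_pow]
    ring
  have hcont : ∀ s, Continuous (Function.uncurry (f s)) := by
    intro s
    have hu : TendstoUniformly (fun n => Function.uncurry (picard ℓ f₀ n s))
        (Function.uncurry (f s)) Filter.atTop := by
      rw [Metric.tendstoUniformly_iff]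
      intro ε hε
      filter_upwards [(hgeom ((2 * k) ^ s)).eventually_lt_const hε] with n hn p
      rw [dist_comm, Real.dist_eq]
      refine ((hdist s p.1 p.2 n).trans ?_).trans_lt hn
      refine mul_le_mul_of_nonneg_left ?_ (by positivity)
      refine (weight_le_energy hβ hk (le_max_right p.1 0) p.2).trans ?_
      refine mul_le_of_le_one_right (by positivity) (exp_le_one_iff.mpr ?_)
      nlinarith [energy_nonneg p.2]
    exact hu.continuous (Filter.Frequently.of_forall fun n => (hadm n).continuous s)
  have hA : Admissible β k 2 f := by
    refine ⟨zero_le_two, hcont, fun s hs t ht Z => ?_, fun s t Z => ?_⟩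
    · exact le_of_tendsto' (hf s t Z).abs fun n => (hadm n).bound s hs t ht Z
    · refine tendsto_nhds_unique (hf s (max t 0) Z) ((hf s t Z).congr fun n => ?_)
      exact ((hadm n).max_zero s t Z).symm
  refine ⟨f, hA, fun s σ t Z => ?_, fun s t ht Z => ?_⟩
  · refine tendsto_nhds_unique (hf s t (Z ∘ σ)) ((hf s t Z).congr fun n => ?_)
    exact (picard_comp_perm hsymm n s σ t Z).symm
  · have hD : Filter.Tendsto (fun n => duhamel ℓ (picard ℓ f₀ n) s t Z) Filter.atTop
        (nhds (duhamel ℓ f s t Z)) := by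
      rw [tendsto_iff_dist_tendsto_zero]
      refine squeeze_zero (fun _ => dist_nonneg) (fun n => ?_) (hgeom (weight β k t Z / 2))
      have h := abs_duhamel_sub_le hβ hk hℓ hsmall (hadm n) hA (K := 2 / 2 ^ n) (by positivity)
        (fun s _ t ht Z => by simpa [max_eq_left ht] using hdist s t Z n) s ht Z
      rw [Real.dist_eq]
      exact h.trans_eq (by ring)
    exact tendsto_nhds_unique ((Filter.tendsto_add_atTop_iff_nat 1).mpr (hf s t Z))
      (hD.const_add (freeTransport f₀ s t Z))

lemma mild_flow_iff {d : ℕ} {ℓ : ℝ} {f₀ : (s : ℕ) → Phase d s → ℝ}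
    {f : (s : ℕ) → ℝ → Phase d s → ℝ} (s : ℕ) :
    (∀ t, 0 ≤ t → ∀ Z, f s t Z = freeTransport f₀ s t Z + duhamel ℓ f s t Z) ↔
    ∀ t, 0 ≤ t → ∀ Z, f s t (freeFlow t Z) = f₀ s Z
      + ∫ τ in (0 : ℝ)..t, ℓ⁻¹ * BoltzCollOp d s (f (s + 1) τ) (freeFlow τ Z) := by
  constructor
  · intro h t ht Z
    rw [h t ht, freeTransport, duhamel, max_eq_left ht, freeFlow_add, add_neg_cancel,
      freeFlow_zero]
  · intro h t ht Z
    have := h t ht (freeFlow (-t) Z)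
    rw [freeFlow_add t, neg_add_cancel, freeFlow_zero] at this
    rwa [freeTransport, duhamel, max_eq_left ht]

lemma solvesBoltzmannHierarchy_iff_mild {d : ℕ} {β k N ℓ : ℝ} (hβ : 0 < β) (hk : 0 < k)
    {f₀ : (s : ℕ) → Phase d s → ℝ} {f : (s : ℕ) → ℝ → Phase d s → ℝ} (hf : Admissible β k N f)
    (h0 : ∀ s Z, f s 0 Z = f₀ s Z) :
    SolvesBoltzmannHierarchy d ℓ (Set.Ioi 0) f ↔ ∀ s, 1 ≤ s → ∀ t, 0 ≤ t → ∀ Z,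
      f s t Z = freeTransport f₀ s t Z + duhamel ℓ f s t Z := by
  refine forall₂_congr fun s _ => ?_
  rw [mild_flow_iff]
  simp only [← h0]
  have e : ∀ φ : ℝ → Phase d s → ℝ,
      ∫ t in Set.Ioi (0 : ℝ), ∫ Z, (transportD φ t Z * f s t Z
        + ℓ⁻¹ * φ t Z * BoltzCollOp d s (f (s + 1) t) Z)
      = ∫ t in Set.Ioi (0 : ℝ), ∫ Z, (transportD φ t Z * f s t Z
        + φ t Z * (ℓ⁻¹ * BoltzCollOp d s (f (s + 1) t) Z)) := fun φ => by
    simp only [mul_comm ℓ⁻¹ (φ _ _), mul_assoc]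
  simp only [e]
  exact ⟨fun h => transport_mild_of_weak (hf.continuous s) (hf.continuous_collision hβ hk ℓ s) h,
    fun h φ hφ hc hS => transport_weak_of_mild (hf.continuous s)
      (hf.continuous_collision hβ hk ℓ s) h hφ hc hS⟩

lemma abs_mul_exp_le_iff {d s : ℕ} (β μ C t : ℝ) (a : ℝ) (Z : Phase d s) :
    |a| * exp (β * (energy Z + inertiaShift t Z)) * exp (μ * s) ≤ C ↔
      |a| ≤ C * (exp (-μ) ^ s * ∏ i, gau β t (Z i)) := by
  rw [prod_gau, ← exp_nat_mul, ← le_div_iff₀ (exp_pos _), ← le_div_iff₀ (exp_pos _),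
    div_eq_mul_inv, div_eq_mul_inv, ← exp_neg, ← exp_neg, mul_assoc, mul_neg, mul_comm μ]

/-- The extension of a good solution to all times is admissible and solves the mild formulation. -/
lemma GoodGlobalSol.admissible_and_mild {d : ℕ} {ℓ β₀ μ₀ : ℝ} (hβ : 0 < β₀)
    {f₀ : (s : ℕ) → Phase d s → ℝ} {g : (s : ℕ) → ℝ → Phase d s → ℝ}
    (hg : GoodGlobalSol d ℓ β₀ μ₀ f₀ g) :
    Admissible (1 / 2 * β₀) (exp (-(μ₀ - 1))) 2 (fun s t Z => g s (max t 0) Z) ∧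
      ∀ s, 1 ≤ s → ∀ t, 0 ≤ t → ∀ Z, g s (max t 0) Z
        = freeTransport f₀ s t Z + duhamel ℓ (fun s t Z => g s (max t 0) Z) s t Z := by
  obtain ⟨hc, -, h0, hb, hw⟩ := hg
  have hβ' : 0 < 1 / 2 * β₀ := by positivity
  have hA : Admissible (1 / 2 * β₀) (exp (-(μ₀ - 1))) 2 (fun s t Z => g s (max t 0) Z) := by
    refine ⟨zero_le_two, fun s => ?_, fun s hs t ht Z => ?_, fun s t Z => by simp⟩
    · exact (hc s).comp_continuous (f := fun p : ℝ × Phase d s => (max p.1 0, p.2)) (by fun_prop)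
        fun p => ⟨le_max_right p.1 0, trivial⟩
    · have h := (abs_mul_exp_le_iff _ _ _ _ _ _).mp (hb t ht s hs Z)
      rw [max_eq_left ht]
      exact h.trans (mul_le_mul_of_nonneg_left (le_weight hβ' (exp_pos _) ht Z) zero_le_two)
  refine ⟨hA, (solvesBoltzmannHierarchy_iff_mild hβ' (exp_pos _) hA fun s Z => ?_).mp ?_⟩
  · rw [max_self, h0]
  · intro s hs φ hφ hφc hS
    refine Eq.trans ?_ (hw s hs φ hφ hφc hS)
    refine setIntegral_congr_fun measurableSet_Ioi fun t ht => ?_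
    simp only [max_eq_left (le_of_lt (Set.mem_Ioi.mp ht))]

lemma rateBound_half {d : ℕ} {β₀ : ℝ} (hβ : 0 < β₀) :
    rateBound d (1 / 2 * β₀) = (4 * π) ^ (((d : ℝ) + 1) / 2) * β₀ ^ (-((d : ℝ) + 1) / 2) := by
  have hp : 0 < 4 * π := by positivity
  have hq : π / (1 / 2 * β₀ / 2) = 4 * π / β₀ := by
    field_simp
    norm_num
  rw [rateBound, hq, sqrt_eq_rpow, ← rpow_add (by positivity), div_rpow hp.le hβ.le, neg_div,
    rpow_neg hβ.le, div_eq_mul_inv]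
  congr 2 <;> ring_nf

lemma abs_freeTransport_le_weight {d : ℕ} {β₀ μ₀ : ℝ} (hβ : 0 < β₀)
    {f₀ : (s : ℕ) → Phase d s → ℝ}
    (hb : ∀ s : ℕ, 1 ≤ s → ∀ Z : Phase d s,
      |f₀ s Z| * exp (β₀ * (energy Z + inertia Z)) * exp (μ₀ * s) ≤ 1)
    (s : ℕ) (hs : 1 ≤ s) (t : ℝ) (ht : 0 ≤ t) (Z : Phase d s) :
    |freeTransport f₀ s t Z| ≤ weight (1 / 2 * β₀) (exp (-μ₀)) t Z := by
  have h := hb s hs (freeFlow (-t) Z)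
  have hE : energy (freeFlow (-t) Z) = energy Z := rfl
  have hI : inertia (freeFlow (-t) Z) = inertiaShift t Z := by
    simp [inertia, inertiaShift, freeFlow, sub_eq_add_neg]
  rw [hE, hI] at h
  rw [freeTransport, max_eq_left ht]
  have hnn : 0 ≤ energy Z + inertiaShift t Z :=
    add_nonneg (energy_nonneg Z) (by unfold inertiaShift; positivity)
  have h' : |f₀ s (freeFlow (-t) Z)| * exp (1 / 2 * β₀ * (energy Z + inertiaShift t Z))
      * exp (μ₀ * s) ≤ 1 := by
    refine le_trans ?_ h
    gcongr
    linarith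
  rw [abs_mul_exp_le_iff, one_mul] at h'
  exact h'.trans (le_weight (by positivity) (exp_pos _) ht Z)

/-- **Global well-posedness of the Boltzmann hierarchy near vacuum (Theorem 11.1,
Illner–Pulvirenti).** For `d ≥ 3` there is `c_d > 0` such that: for continuous symmetric
data with `|f_∞^{(s)}(0)| e^{β₀[E_s+I_s]} e^{μ₀ s} ≤ 1`, if
`ℓ⁻¹ e^{−μ₀} β₀^{−(d+1)/2} ≤ c_d`, there is a unique continuous symmetric solution of
the Boltzmann hierarchy on `[0,∞)` attaining the data and satisfying
`|f_∞^{(s)}(t)| e^{(1/2)β₀[E_s + I_s((X−Vt,V))]} e^{(μ₀−1)s} ≤ 2`. -/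
theorem boltzmann_hierarchy_global_wellposedness_near_vacuum
    (d : ℕ) (hd : 3 ≤ d) :
    ∃ c : ℝ, 0 < c ∧
      ∀ (ℓ β₀ μ₀ : ℝ) (f₀ : (s : ℕ) → Phase d s → ℝ),
        0 < ℓ → 0 < β₀ →
        (∀ s : ℕ, Continuous (f₀ s)) →
        (∀ s : ℕ, ∀ σ : Equiv.Perm (Fin s), ∀ Z : Phase d s, f₀ s (Z ∘ σ) = f₀ s Z) →
        (∀ s : ℕ, 1 ≤ s → ∀ Z : Phase d s,
          |f₀ s Z| * exp (β₀ * (energy Z + inertia Z)) * exp (μ₀ * s) ≤ 1) →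
        ℓ⁻¹ * exp (-μ₀) * β₀ ^ (-((d : ℝ) + 1) / 2) ≤ c →
        ∃ f : (s : ℕ) → ℝ → Phase d s → ℝ,
          GoodGlobalSol d ℓ β₀ μ₀ f₀ f ∧
          ∀ g : (s : ℕ) → ℝ → Phase d s → ℝ,
            GoodGlobalSol d ℓ β₀ μ₀ f₀ g →
            ∀ s : ℕ, 1 ≤ s → ∀ t : ℝ, 0 ≤ t → ∀ Z : Phase d s, g s t Z = f s t Z := by
  set D : ℝ := 8 * (sphArea d + 1) * exp 1 * (4 * π) ^ (((d : ℝ) + 1) / 2) with hD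
  have hσ := sphArea_nonneg d
  have hP : 0 < (4 * π) ^ (((d : ℝ) + 1) / 2) := rpow_pos_of_pos (by positivity) _
  have hDpos : 0 < D := by positivity
  refine ⟨D⁻¹, inv_pos.mpr hDpos, fun ℓ β₀ μ₀ f₀ hℓ hβ hc hsymm hb hs => ?_⟩
  have hβ' : 0 < 1 / 2 * β₀ := by positivity
  have hexp : exp (-(μ₀ - 1)) = exp 1 * exp (-μ₀) := by
    rw [← exp_add]
    ring_nf
  have hk : 2 * exp (-μ₀) ≤ exp (-(μ₀ - 1)) := by
    rw [hexp]
    gcongr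
    linarith [add_one_le_exp 1]
  have hsmall' : ℓ⁻¹ * (4 * sphArea d * exp (-(μ₀ - 1)) * rateBound d (1 / 2 * β₀)) ≤ 1 / 2 := by
    rw [rateBound_half hβ, hexp]
    have hA : 0 ≤ ℓ⁻¹ * exp (-μ₀) * β₀ ^ (-((d : ℝ) + 1) / 2) := by positivity
    calc _ = (4 * sphArea d * exp 1 * (4 * π) ^ (((d : ℝ) + 1) / 2))
          * (ℓ⁻¹ * exp (-μ₀) * β₀ ^ (-((d : ℝ) + 1) / 2)) := by ring
      _ ≤ (D / 2) * D⁻¹ := by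
          refine mul_le_mul ?_ hs hA (by positivity)
          rw [hD]
          have : 0 < exp 1 * (4 * π) ^ (((d : ℝ) + 1) / 2) := by positivity
          nlinarith
      _ = 1 / 2 := by field_simp
  have hsmall : ℓ⁻¹ * (4 * sphArea d * exp (-μ₀) * rateBound d (1 / 2 * β₀)) ≤ 1 / 2 := by
    refine le_trans ?_ hsmall'
    have := (rateBound_pos d hβ').le
    gcongr
    linarith
  obtain ⟨f, hfA, hfs, hfm⟩ := exists_mild hβ' (exp_pos (-μ₀)) hℓ hsmall hc hsymm
    (abs_freeTransport_le_weight hβ hb)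
  have hf0 : ∀ s Z, f s 0 Z = f₀ s Z := fun s Z => by
    rw [hfm s 0 le_rfl Z]
    simp [freeTransport, duhamel]
  have hgood : GoodGlobalSol d ℓ β₀ μ₀ f₀ f := by
    refine ⟨fun s => (hfA.continuous s).continuousOn, hfs, hf0, fun t ht s hs Z => ?_,
      (solvesBoltzmannHierarchy_iff_mild hβ' (exp_pos _) hfA hf0).mpr fun s _ => hfm s⟩
    rw [abs_mul_exp_le_iff]
    refine (hfA.bound s hs t ht Z).trans (mul_le_mul_of_nonneg_left ?_ zero_le_two)
    refine (weight_le hβ' (exp_pos _) ht Z).trans ?_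
    have : 0 ≤ ∏ i, gau (1 / 2 * β₀) t (Z i) := Finset.prod_nonneg fun _ _ => (gau_pos _ _ _).le
    gcongr
  refine ⟨f, hgood, fun g hg s hs t ht Z => ?_⟩
  obtain ⟨hgA, hgm⟩ := hg.admissible_and_mild hβ
  obtain ⟨hfA', hfm'⟩ := hgood.admissible_and_mild hβ
  simpa [max_eq_left ht] using
    eq_of_mild hβ' (exp_pos _) hℓ hsmall' hgA hfA' hgm hfm' hs ht Z
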